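/- arXiv:2405.04385 — 3 statements merged into one kernel-verified Lean document; each statement's English description precedes it below -/
import Mathlib

section
/- Let α ∈ {−1/d : d ∈ ℕ, d ≥ 2} ∪ [0,∞), q ∈ [0,1] with q ≥ (α+1)/4, and let (Δ(n))_{n≥1} be any very simple increasing color-difference process with parameters (α, q) on a probability space (Ω, 𝒜, μ). Then limsup_{N→∞} [ μ(Δ₁(N) < 0) + (1/2)·μ(Δ₁(N) = 0) ] = 1/2. -/
open MeasureTheory Filter
open scoped ENat


/-- Normalisation `Z_α(n) = α(1 - 1/n) + 1` for very simple increasing trees. -/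
noncomputable def Zvs (α : ℝ) (n : ℕ) : ℝ := α * (1 - 1 / (n : ℝ)) + 1

/-- `p(n, x₁, x₂) = (1/2)(1 + (x₁ + α x₂)/(Z_α(n) n))`, the probability that the new vertex
attaches to a red vertex. -/
noncomputable def pvs (α : ℝ) (n : ℕ) (x₁ x₂ : ℤ) : ℝ :=
  (1 / 2) * (1 + ((x₁ : ℝ) + α * (x₂ : ℝ)) / (Zvs α n * (n : ℝ)))

/-- The set of allowed parameters `α ∈ {-1/d : d ∈ ℕ, d ≥ 2} ∪ [0, ∞)` for
very simple increasing trees. -/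
def vsiAllowed : Set ℝ := {x : ℝ | ∃ d : ℕ, 2 ≤ d ∧ x = -1 / (d : ℝ)} ∪ Set.Ici (0 : ℝ)

/-- A very simple increasing (v.s.i.) color-difference process with parameters `(α, q)` on the
measurable space `Ω`: a probability measure `μ`, a filtration `F`, and an adapted `ℤ²`-valued
process `Δ` with `Δ(1) = (1,0)`, whose increments `D(n) = Δ(n+1) - Δ(n)` are
`F(n+1)`-measurable with values in `{(1,1), (-1,1), (1,-1), (-1,-1)}`, and whose conditional
probabilities given `F n` (conditional expectations of indicator functions) are as prescribed. -/
structure VSIProcess (α q : ℝ) (Ω : Type) [mΩ : MeasurableSpace Ω] where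
  μ : Measure Ω
  isProb : IsProbabilityMeasure μ
  F : ℕ → MeasurableSpace Ω
  F_le : ∀ n, F n ≤ mΩ
  F_mono : Monotone F
  Δ : ℕ → Ω → ℤ × ℤ
  adapted : ∀ n, 1 ≤ n → @Measurable Ω (ℤ × ℤ) (F n) _ (Δ n)
  init : ∀ ω, Δ 1 ω = (1, 0)
  D_meas : ∀ n, 1 ≤ n → @Measurable Ω (ℤ × ℤ) (F (n + 1)) _ (fun ω => Δ (n + 1) ω - Δ n ω)
  D_range : ∀ n, 1 ≤ n → ∀ ω,
    Δ (n + 1) ω - Δ n ω ∈ ({(1, 1), (-1, 1), (1, -1), (-1, -1)} : Set (ℤ × ℤ))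
  cond_rr : ∀ n, 1 ≤ n →
    μ[Set.indicator {ω | Δ (n + 1) ω - Δ n ω = (1, 1)} (fun _ => (1 : ℝ)) | F n]
      =ᵐ[μ] fun ω => pvs α n (Δ n ω).1 (Δ n ω).2 * (1 - q)
  cond_br : ∀ n, 1 ≤ n →
    μ[Set.indicator {ω | Δ (n + 1) ω - Δ n ω = (-1, 1)} (fun _ => (1 : ℝ)) | F n]
      =ᵐ[μ] fun ω => pvs α n (Δ n ω).1 (Δ n ω).2 * q
  cond_rb : ∀ n, 1 ≤ n →
    μ[Set.indicator {ω | Δ (n + 1) ω - Δ n ω = (1, -1)} (fun _ => (1 : ℝ)) | F n]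
      =ᵐ[μ] fun ω => (1 - pvs α n (Δ n ω).1 (Δ n ω).2) * q
  cond_bb : ∀ n, 1 ≤ n →
    μ[Set.indicator {ω | Δ (n + 1) ω - Δ n ω = (-1, -1)} (fun _ => (1 : ℝ)) | F n]
      =ᵐ[μ] fun ω => (1 - pvs α n (Δ n ω).1 (Δ n ω).2) * (1 - q)

/-- `τ_high(A) = inf {n ≥ 1 : Δ₁(n) + α Δ₂(n) > A Z_α(n) √n}`, with value `∞` if no such `n`
exists. -/
noncomputable def tauHigh {α q : ℝ} {Ω : Type} [MeasurableSpace Ω]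
    (P : VSIProcess α q Ω) (A : ℝ) (ω : Ω) : ℕ∞ :=
  sInf {N : ℕ∞ | ∃ n : ℕ, N = (n : ℕ∞) ∧ 1 ≤ n ∧
    A * Zvs α n * Real.sqrt n < ((P.Δ n ω).1 : ℝ) + α * ((P.Δ n ω).2 : ℝ)}

/-- `τ_low(B) = inf {n > τ_high(A) : Δ₁(n) + α Δ₂(n) ≤ B Z_α(n) √n}`, with value `∞` if no such
`n` exists. -/
noncomputable def tauLow {α q : ℝ} {Ω : Type} [MeasurableSpace Ω]
    (P : VSIProcess α q Ω) (A B : ℝ) (ω : Ω) : ℕ∞ :=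
  sInf {N : ℕ∞ | ∃ n : ℕ, N = (n : ℕ∞) ∧ tauHigh P A ω < (n : ℕ∞) ∧
    ((P.Δ n ω).1 : ℝ) + α * ((P.Δ n ω).2 : ℝ) ≤ B * Zvs α n * Real.sqrt n}

theorem aux_exp3 (x : ℝ) :
    ‖Complex.exp (x * Complex.I) - (1 + x * Complex.I - x ^ 2 / 2)‖ ≤ 4 * |x| ^ 3 := by
  rcases le_or_gt |x| 1 with h | h
  · have hx : ‖(x : ℂ) * Complex.I‖ ≤ 1 := by simpa using h
    have := Complex.exp_bound hx (n := 3) (by norm_num)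
    have e : ∑ m ∈ Finset.range 3, ((x : ℂ) * Complex.I) ^ m / (m.factorial : ℂ)
        = 1 + x * Complex.I - x ^ 2 / 2 := by
      simp [Finset.sum_range_succ, mul_pow, Nat.factorial]; ring
    rw [e] at this
    refine this.trans ?_
    have h3 : 0 ≤ |x| ^ 3 := by positivity
    simp [Nat.factorial]
    nlinarith
  · have h1 : ‖Complex.exp (x * Complex.I)‖ = 1 := Complex.norm_exp_ofReal_mul_I x
    have h2 : ‖(1 + x * Complex.I - x ^ 2 / 2 : ℂ)‖ ≤ 1 + |x| + |x| ^ 2 / 2 := by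
      refine (norm_sub_le _ _).trans ?_
      have := norm_add_le (1 : ℂ) (x * Complex.I)
      simp at this ⊢
      linarith
    refine (norm_sub_le _ _).trans ?_
    rw [h1]
    nlinarith [sq_nonneg (|x|), mul_pos (by linarith : 0 < |x|) (by linarith : 0 < |x| - 1),
      mul_pos (mul_pos (by linarith : 0 < |x|) (by linarith : 0 < |x|))
        (by linarith : 0 < |x| - 1)]

theorem aux_expneg (s : ℝ) (hs : 0 ≤ s) : |1 - s - Real.exp (-s)| ≤ s ^ 2 := by
  rcases le_or_gt s 1 with h | h
  · have := Real.exp_bound (x := -s) (by rw [abs_neg, abs_of_nonneg hs]; exact h) (n := 2)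
      (by norm_num)
    simp [Finset.sum_range_succ] at this
    rw [abs_sub_comm]
    have e : Real.exp (-s) - (1 - s) = Real.exp (-s) - (1 + -s) := by ring
    rw [e]
    nlinarith [sq_nonneg s]
  · have h1 := Real.exp_pos (-s)
    have h2 : Real.exp (-s) ≤ 1 := Real.exp_le_one_iff.2 (by linarith)
    rw [abs_le]; constructor <;> nlinarith

/-- the quadratic form of conditional second moments -/
noncomputable def Qv (q a b : ℝ) : ℝ := (1 - q) * (a + b) ^ 2 + q * (a - b) ^ 2

theorem Qv_nonneg {q : ℝ} (h0 : 0 ≤ q) (h1 : q ≤ 1) (a b : ℝ) : 0 ≤ Qv q a b := by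
  unfold Qv
  have : 0 ≤ 1 - q := by linarith
  positivity

theorem Qv_ge {q : ℝ} (h0 : 0 ≤ q) (h1 : q ≤ 1) (a b : ℝ) :
    ((1 - 2 * q) * a + b) ^ 2 ≤ Qv q a b := by
  unfold Qv
  nlinarith [mul_nonneg (mul_nonneg h0 (by linarith : 0 ≤ 1 - q)) (sq_nonneg a)]

theorem aux_cube {l k v x y m s : ℝ} (hl1 : l ≤ 1) (hk : 0 < k) (hk1 : k ≤ 1)
    (h : l = 0 ∨ k ≤ l) (hs : 0 ≤ s) (hv : s ^ 2 = v)
    (hx : l * x ^ 2 ≤ v) (hm : m ^ 2 ≤ v) (hy : y = x - m ∨ y = - x - m) :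
    l * |y| ^ 3 ≤ 8 / k ^ 3 * s ^ 3 := by
  rcases h with h | h
  · rw [h]; simp; positivity
  · have h1 : k * |x| ≤ s := by
      apply abs_le_of_sq_le_sq' _ hs |>.2
      rw [mul_pow, sq_abs, hv]
      nlinarith [sq_nonneg x, mul_nonneg (sq_nonneg x) (by nlinarith : 0 ≤ l - k ^ 2)]
    have h2 : |m| ≤ s := by
      apply abs_le_of_sq_le_sq' _ hs |>.2
      rw [sq_abs, hv]; exact hm
    have h3 : |y| ≤ |x| + |m| := by
      rcases hy with rfl | rfl
      · exact abs_sub _ _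
      · simpa using abs_sub (-x) m
    have h4 : k * |y| ≤ 2 * s := by nlinarith [abs_nonneg m]
    have h5 : (k * |y|) ^ 3 ≤ (2 * s) ^ 3 := pow_le_pow_left₀ (by positivity) h4 3
    rw [div_mul_eq_mul_div, le_div_iff₀ (by positivity)]
    have h6 : 0 ≤ |y| ^ 3 := by positivity
    have h7 : 0 ≤ |y| ^ 3 * k ^ 3 := by positivity
    nlinarith

theorem aux_onestep {p q k a b : ℝ} (hp0 : 0 ≤ p) (hp1 : p ≤ 1) (hq0 : 0 ≤ q) (hq1 : q ≤ 1)
    (hk : 0 < k) (hk1 : k ≤ 1) (hkq : q = 0 ∨ k ≤ q) (hkq' : 1 - q = 0 ∨ k ≤ 1 - q)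
    (m : ℝ) (hm : m = (2 * p - 1) * ((1 - 2 * q) * a + b)) :
    ‖(((p * (1 - q) : ℝ) : ℂ) * Complex.exp ((a + b - m : ℝ) * Complex.I) +
      ((p * q : ℝ) : ℂ) * Complex.exp ((-a + b - m : ℝ) * Complex.I) +
      (((1 - p) * q : ℝ) : ℂ) * Complex.exp ((a - b - m : ℝ) * Complex.I) +
      (((1 - p) * (1 - q) : ℝ) : ℂ) * Complex.exp ((-a - b - m : ℝ) * Complex.I)) -
      (Real.exp (-(Qv q a b) / 2) : ℝ)‖ ≤
      (2 * p - 1) ^ 2 * Qv q a b + 64 / k ^ 3 * (Real.sqrt (Qv q a b)) ^ 3 + (Qv q a b) ^ 2 := by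
  set v := Qv q a b with hv
  have hv0 : 0 ≤ v := Qv_nonneg hq0 hq1 a b
  set s := Real.sqrt v with hs
  have hs0 : 0 ≤ s := Real.sqrt_nonneg _
  have hs2 : s ^ 2 = v := Real.sq_sqrt hv0
  have hQ := Qv_ge hq0 hq1 a b
  rw [← hv] at hQ
  have hm2 : m ^ 2 ≤ (2 * p - 1) ^ 2 * v := by
    rw [hm, mul_pow]; exact mul_le_mul_of_nonneg_left hQ (sq_nonneg _)
  have hm3 : m ^ 2 ≤ v := by nlinarith [mul_nonneg hp0 (by linarith : 0 ≤ 1 - p)]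
  have hq' : 0 ≤ 1 - q := by linarith
  have hp' : 0 ≤ 1 - p := by linarith
  have hx1 : (1 - q) * (a + b) ^ 2 ≤ v := by
    rw [hv]; unfold Qv; nlinarith [mul_nonneg hq0 (sq_nonneg (a - b))]
  have hx2 : q * (a - b) ^ 2 ≤ v := by
    rw [hv]; unfold Qv; nlinarith [mul_nonneg hq' (sq_nonneg (a + b))]
  have c1 := aux_cube (y := a + b - m) (by linarith) hk hk1 hkq' hs0 hs2 hx1 hm3 (Or.inl rfl)
  have c4 := aux_cube (y := - a - b - m) (by linarith) hk hk1 hkq' hs0 hs2 hx1 hm3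
    (Or.inr (by ring))
  have c3 := aux_cube (y := a - b - m) hq1 hk hk1 hkq hs0 hs2 hx2 hm3 (Or.inl rfl)
  have c2 := aux_cube (y := - a + b - m) hq1 hk hk1 hkq hs0 hs2 hx2 hm3 (Or.inr (by ring))
  have key : ((((p * (1 - q) : ℝ) : ℂ) * Complex.exp ((a + b - m : ℝ) * Complex.I) +
      ((p * q : ℝ) : ℂ) * Complex.exp ((-a + b - m : ℝ) * Complex.I) +
      (((1 - p) * q : ℝ) : ℂ) * Complex.exp ((a - b - m : ℝ) * Complex.I) +
      (((1 - p) * (1 - q) : ℝ) : ℂ) * Complex.exp ((-a - b - m : ℝ) * Complex.I)) -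
      (Real.exp (-v / 2) : ℝ)) =
    ((p * (1 - q) : ℝ) : ℂ) * (Complex.exp ((a + b - m : ℝ) * Complex.I)
        - (1 + (a + b - m : ℝ) * Complex.I - (a + b - m : ℝ) ^ 2 / 2)) +
      ((p * q : ℝ) : ℂ) * (Complex.exp ((-a + b - m : ℝ) * Complex.I)
        - (1 + (-a + b - m : ℝ) * Complex.I - (-a + b - m : ℝ) ^ 2 / 2)) +
      (((1 - p) * q : ℝ) : ℂ) * (Complex.exp ((a - b - m : ℝ) * Complex.I)
        - (1 + (a - b - m : ℝ) * Complex.I - (a - b - m : ℝ) ^ 2 / 2)) +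
      (((1 - p) * (1 - q) : ℝ) : ℂ) * (Complex.exp ((-a - b - m : ℝ) * Complex.I)
        - (1 + (-a - b - m : ℝ) * Complex.I - (-a - b - m : ℝ) ^ 2 / 2)) +
      ((m ^ 2 / 2 : ℝ) : ℂ) + ((1 - v / 2 - Real.exp (-(v / 2)) : ℝ) : ℂ) := by
    rw [neg_div, hv, Qv, hm]
    push_cast
    ring
  rw [key]
  have e1 := aux_exp3 (a + b - m)
  have e2 := aux_exp3 (-a + b - m)
  have e3 := aux_exp3 (a - b - m)
  have e4 := aux_exp3 (-a - b - m)
  have e5 := aux_expneg (v / 2) (by linarith)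
  have n0 : ∀ (w : ℝ) (z : ℂ), 0 ≤ w → ‖(w : ℂ) * z‖ = w * ‖z‖ := by
    intro w z hw
    rw [norm_mul, Complex.norm_real, Real.norm_of_nonneg hw]
  have n6 : ∀ z1 z2 z3 z4 z5 z6 : ℂ, ‖z1 + z2 + z3 + z4 + z5 + z6‖ ≤
      ‖z1‖ + ‖z2‖ + ‖z3‖ + ‖z4‖ + ‖z5‖ + ‖z6‖ := by
    intro z1 z2 z3 z4 z5 z6
    have i1 := norm_add_le (z1 + z2 + z3 + z4 + z5) z6
    have i2 := norm_add_le (z1 + z2 + z3 + z4) z5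
    have i3 := norm_add_le (z1 + z2 + z3) z4
    have i4 := norm_add₃_le (a := z1) (b := z2) (c := z3)
    linarith
  refine (n6 _ _ _ _ _ _).trans ?_
  rw [n0 _ _ (by positivity), n0 _ _ (by positivity), n0 _ _ (by positivity),
    n0 _ _ (by positivity), Complex.norm_real, Complex.norm_real,
    Real.norm_of_nonneg (by positivity : 0 ≤ m ^ 2 / 2), Real.norm_eq_abs]
  have f1 := mul_le_mul_of_nonneg_left e1 (by positivity : 0 ≤ p * (1 - q))
  have f2 := mul_le_mul_of_nonneg_left e2 (by positivity : 0 ≤ p * q)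
  have f3 := mul_le_mul_of_nonneg_left e3 (by positivity : 0 ≤ (1 - p) * q)
  have f4 := mul_le_mul_of_nonneg_left e4 (by positivity : 0 ≤ (1 - p) * (1 - q))
  have g1 := mul_le_mul_of_nonneg_left c1 hp0
  have g2 := mul_le_mul_of_nonneg_left c2 hp0
  have g3 := mul_le_mul_of_nonneg_left c3 hp'
  have g4 := mul_le_mul_of_nonneg_left c4 hp'
  have : 64 / k ^ 3 * s ^ 3 = 8 * (8 / k ^ 3 * s ^ 3) := by ring
  rw [this]
  set R := 8 / k ^ 3 * s ^ 3
  have hR : 0 ≤ R := by positivity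
  nlinarith [sq_nonneg v, sq_nonneg m]
section proc

set_option linter.unusedSectionVars false

variable {α q : ℝ} {Ω : Type} [mΩ : MeasurableSpace Ω] (P : VSIProcess α q Ω)

theorem VSI_meas {n : ℕ} (hn : 1 ≤ n) : Measurable (P.Δ n) :=
  (P.adapted n hn).mono (P.F_le n) le_rfl

theorem VSI_box {n : ℕ} (hn : 1 ≤ n) (ω : Ω) :
    P.Δ n ω ∈ (Finset.Icc (-(n : ℤ)) n ×ˢ Finset.Icc (-(n : ℤ)) n : Finset (ℤ × ℤ)) := by
  induction n, hn using Nat.le_induction with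
  | base => rw [P.init]; simp
  | succ n hn ih =>
    have h := P.D_range n hn ω
    simp only [Set.mem_insert_iff, Set.mem_singleton_iff, Prod.ext_iff, Prod.fst_sub,
      Prod.snd_sub] at h
    simp only [Finset.mem_product, Finset.mem_Icc] at ih ⊢
    push_cast
    omega

variable {E : Type} [NormedAddCommGroup E] [NormedSpace ℝ E] [CompleteSpace E]

theorem VSI_bdd {n : ℕ} (hn : 1 ≤ n) (Φ : ℤ × ℤ → E) : ∃ C, ∀ ω, ‖Φ (P.Δ n ω)‖ ≤ C := by
  refine ⟨∑ x ∈ (Finset.Icc (-(n : ℤ)) n ×ˢ Finset.Icc (-(n : ℤ)) n : Finset (ℤ × ℤ)), ‖Φ x‖,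
    fun ω => ?_⟩
  exact Finset.single_le_sum (f := fun x => ‖Φ x‖) (fun _ _ => norm_nonneg _) (VSI_box P hn ω)

theorem VSI_integrable {n : ℕ} (hn : 1 ≤ n) (Φ : ℤ × ℤ → E) :
    Integrable (fun ω => Φ (P.Δ n ω)) P.μ := by
  have := P.isProb
  obtain ⟨C, hC⟩ := VSI_bdd P hn Φ
  refine Integrable.of_bound (C := C) ?_ (Filter.Eventually.of_forall hC)
  exact ((StronglyMeasurable.of_discrete (f := Φ)).comp_measurable
    (VSI_meas P hn)).aestronglyMeasurable

theorem VSI_pull {n : ℕ} (hn : 1 ≤ n) (Φ : ℤ × ℤ → E) (d : ℤ × ℤ) (r : ℤ × ℤ → ℝ)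
    (h : P.μ[Set.indicator {ω | P.Δ (n + 1) ω - P.Δ n ω = d} (fun _ => (1 : ℝ)) | P.F n]
      =ᵐ[P.μ] fun ω => r (P.Δ n ω)) :
    Integrable (fun ω => Set.indicator {ω | P.Δ (n + 1) ω - P.Δ n ω = d} (fun _ => (1 : ℝ)) ω •
      Φ (P.Δ n ω)) P.μ ∧
    ∫ ω, Set.indicator {ω | P.Δ (n + 1) ω - P.Δ n ω = d} (fun _ => (1 : ℝ)) ω • Φ (P.Δ n ω) ∂P.μ
      = ∫ ω, r (P.Δ n ω) • Φ (P.Δ n ω) ∂P.μ := by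
  have := P.isProb
  have hD : Measurable (fun ω => P.Δ (n + 1) ω - P.Δ n ω) :=
    (P.D_meas n hn).mono (P.F_le _) le_rfl
  have hA : MeasurableSet {ω | P.Δ (n + 1) ω - P.Δ n ω = d} :=
    hD (measurableSet_singleton d)
  have hi : Integrable (Set.indicator {ω | P.Δ (n + 1) ω - P.Δ n ω = d} (fun _ => (1 : ℝ))) P.μ :=
    (integrable_const 1).indicator hA
  have hg : StronglyMeasurable[P.F n] (fun ω => Φ (P.Δ n ω)) :=
    (StronglyMeasurable.of_discrete (f := Φ)).comp_measurable (P.adapted n hn)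
  have hfg : Integrable ((Set.indicator {ω | P.Δ (n + 1) ω - P.Δ n ω = d} (fun _ => (1 : ℝ))) •
      (fun ω => Φ (P.Δ n ω))) P.μ := by
    obtain ⟨C, hC⟩ := VSI_bdd P hn Φ
    refine Integrable.mono' (g := fun _ => C) (integrable_const C) ?_ ?_
    · exact hi.aestronglyMeasurable.smul (hg.mono (P.F_le n)).aestronglyMeasurable
    · refine Filter.Eventually.of_forall fun ω => ?_
      simp only [Pi.smul_apply', norm_smul]
      have h1 : ‖Set.indicator {ω | P.Δ (n + 1) ω - P.Δ n ω = d} (fun _ => (1 : ℝ)) ω‖ ≤ 1 := by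
        refine (norm_indicator_le_norm_self _ _).trans ?_
        simp
      have := mul_le_mul h1 (hC ω) (norm_nonneg _) zero_le_one
      simpa using this
  refine ⟨hfg, ?_⟩
  have := condExp_smul_of_aestronglyMeasurable_right (m := P.F n) hi hfg hg.aestronglyMeasurable
  have e1 := integral_condExp (P.F_le n) (μ := P.μ) (f := ((Set.indicator
    {ω | P.Δ (n + 1) ω - P.Δ n ω = d} (fun _ => (1 : ℝ))) • (fun ω => Φ (P.Δ n ω))))
  refine (e1.symm).trans ?_
  apply integral_congr_ae
  filter_upwards [this, h] with ω h1 h2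
  rw [h1, Pi.smul_apply', h2]

theorem int4 {m : Measure Ω} {f1 f2 f3 f4 : Ω → E} (h1 : Integrable f1 m) (h2 : Integrable f2 m)
    (h3 : Integrable f3 m) (h4 : Integrable f4 m) :
    ∫ ω, (f1 ω + f2 ω + f3 ω + f4 ω) ∂m =
      ∫ ω, f1 ω ∂m + ∫ ω, f2 ω ∂m + ∫ ω, f3 ω ∂m + ∫ ω, f4 ω ∂m := by
  have a : Integrable (fun ω => f1 ω + f2 ω) m := h1.add h2
  have b : Integrable (fun ω => f1 ω + f2 ω + f3 ω) m := a.add h3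
  rw [integral_add b h4, integral_add a h3, integral_add h1 h2]

theorem VSI_step {n : ℕ} (hn : 1 ≤ n) (Φ : ℤ × ℤ → E) :
    ∫ ω, Φ (P.Δ (n + 1) ω) ∂P.μ = ∫ ω,
      ((pvs α n (P.Δ n ω).1 (P.Δ n ω).2 * (1 - q)) • Φ (P.Δ n ω + (1, 1)) +
      (pvs α n (P.Δ n ω).1 (P.Δ n ω).2 * q) • Φ (P.Δ n ω + (-1, 1)) +
      ((1 - pvs α n (P.Δ n ω).1 (P.Δ n ω).2) * q) • Φ (P.Δ n ω + (1, -1)) +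
      ((1 - pvs α n (P.Δ n ω).1 (P.Δ n ω).2) * (1 - q)) • Φ (P.Δ n ω + (-1, -1))) ∂P.μ := by
  have := P.isProb
  obtain ⟨i1, h1⟩ := VSI_pull P hn (fun x => Φ (x + (1, 1))) (1, 1)
    (fun x => pvs α n x.1 x.2 * (1 - q)) (P.cond_rr n hn)
  obtain ⟨i2, h2⟩ := VSI_pull P hn (fun x => Φ (x + (-1, 1))) (-1, 1)
    (fun x => pvs α n x.1 x.2 * q) (P.cond_br n hn)
  obtain ⟨i3, h3⟩ := VSI_pull P hn (fun x => Φ (x + (1, -1))) (1, -1)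
    (fun x => (1 - pvs α n x.1 x.2) * q) (P.cond_rb n hn)
  obtain ⟨i4, h4⟩ := VSI_pull P hn (fun x => Φ (x + (-1, -1))) (-1, -1)
    (fun x => (1 - pvs α n x.1 x.2) * (1 - q)) (P.cond_bb n hn)
  have j1 := VSI_integrable P hn
    (fun x => (pvs α n x.1 x.2 * (1 - q)) • Φ (x + (1, 1)))
  have j2 := VSI_integrable P hn
    (fun x => (pvs α n x.1 x.2 * q) • Φ (x + (-1, 1)))
  have j3 := VSI_integrable P hn
    (fun x => ((1 - pvs α n x.1 x.2) * q) • Φ (x + (1, -1)))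
  have j4 := VSI_integrable P hn
    (fun x => ((1 - pvs α n x.1 x.2) * (1 - q)) • Φ (x + (-1, -1)))
  rw [int4 j1 j2 j3 j4, ← h1, ← h2, ← h3, ← h4, ← int4 i1 i2 i3 i4]
  congr 1
  funext ω
  have h := P.D_range n hn ω
  have e : P.Δ (n + 1) ω = P.Δ n ω + (P.Δ (n + 1) ω - P.Δ n ω) := by abel
  simp only [Set.mem_insert_iff, Set.mem_singleton_iff] at h
  simp only [Set.indicator_apply, Set.mem_setOf_eq]
  rw [e]
  simp only [add_sub_cancel_left]
  rcases h with h | h | h | h <;> rw [h] <;> simp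

theorem VSI_prob {n : ℕ} (hn : 1 ≤ n) :
    ∀ᵐ ω ∂P.μ, 0 ≤ pvs α n (P.Δ n ω).1 (P.Δ n ω).2 ∧ pvs α n (P.Δ n ω).1 (P.Δ n ω).2 ≤ 1 := by
  have h0 : ∀ d : ℤ × ℤ, ∀ᵐ ω ∂P.μ, 0 ≤ (P.μ[Set.indicator {ω | P.Δ (n + 1) ω - P.Δ n ω = d}
      (fun _ => (1 : ℝ)) | P.F n]) ω := fun d => condExp_nonneg (Filter.Eventually.of_forall
        fun ω => Set.indicator_nonneg (fun _ _ => zero_le_one) _)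
  filter_upwards [h0 (1, 1), h0 (-1, 1), h0 (1, -1), h0 (-1, -1), P.cond_rr n hn, P.cond_br n hn,
    P.cond_rb n hn, P.cond_bb n hn] with ω a1 a2 a3 a4 b1 b2 b3 b4
  rw [b1] at a1; rw [b2] at a2; rw [b3] at a3; rw [b4] at a4
  constructor <;> nlinarith

end proc
section det

noncomputable def zz (α : ℝ) (k : ℕ) : ℝ := (1 + α) * k - α

noncomputable def ee (α q : ℝ) (N k : ℕ) : ℝ :=
  (1 - 2 * q) * ∏ j ∈ Finset.Ico k N, (1 + (1 + α - 2 * q) / zz α j)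

noncomputable def gg (α q : ℝ) (N k : ℕ) : ℝ :=
  ∑ j ∈ Finset.Ico k N, ee α q N (j + 1) / zz α j

noncomputable def QQ (α q g : ℝ) : ℝ := Qv q (1 + g) (α * g)

noncomputable def ss (α q : ℝ) (N : ℕ) : ℝ :=
  ∑ k ∈ Finset.Ico 1 N, QQ α q (gg α q N (k + 1))

variable {α q : ℝ}

theorem zz_ge (ha : -1 / 2 ≤ α) {k : ℕ} (hk : 1 ≤ k) : ((k : ℝ) + 1) / 2 ≤ zz α k := by
  have : (1 : ℝ) ≤ k := by exact_mod_cast hk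
  unfold zz; nlinarith

theorem zz_ge_one (ha : -1 / 2 ≤ α) {k : ℕ} (hk : 1 ≤ k) : 1 ≤ zz α k := by
  have : (1 : ℝ) ≤ k := by exact_mod_cast hk
  have := zz_ge ha hk
  linarith

theorem zz_succ (k : ℕ) : zz α (k + 1) = zz α k + (1 + α) := by
  unfold zz; push_cast; ring

theorem ee_rec {N k : ℕ} (h : k < N) :
    ee α q N k = ee α q N (k + 1) * (1 + (1 + α - 2 * q) / zz α k) := by
  unfold ee; rw [Finset.prod_eq_prod_Ico_succ_bot h]; ring

theorem gg_rec {N k : ℕ} (h : k < N) :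
    gg α q N k = gg α q N (k + 1) + ee α q N (k + 1) / zz α k := by
  unfold gg; rw [Finset.sum_eq_sum_Ico_succ_bot h]; ring

theorem gg_self (N : ℕ) : gg α q N N = 0 := by simp [gg]

theorem ee_eq (N : ℕ) : ∀ d k : ℕ, k + d = N →
    ee α q N k = (1 - 2 * q) + (1 + α - 2 * q) * gg α q N k := by
  intro d
  induction d with
  | zero => intro k hk; obtain rfl : k = N := by omega
            simp [ee, gg]
  | succ d ih =>
    intro k hk
    rw [ee_rec (by omega), gg_rec (by omega), ih (k + 1) (by omega)]
    ring

theorem QQ_ge (h0 : 0 ≤ q) (h1 : q ≤ 1) {N k : ℕ} (hk : k ≤ N) :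
    ee α q N k ^ 2 ≤ QQ α q (gg α q N k) := by
  have := Qv_ge h0 h1 (1 + gg α q N k) (α * gg α q N k)
  rw [ee_eq N (N - k) k (by omega)]
  unfold QQ
  refine le_trans (le_of_eq ?_) this
  ring

theorem QQ_nonneg (h0 : 0 ≤ q) (h1 : q ≤ 1) (g : ℝ) : 0 ≤ QQ α q g := Qv_nonneg h0 h1 _ _

theorem QQ_le (ha : -1 / 2 ≤ α) (ha3 : α ≤ 3) (h0 : 0 ≤ q) (h1 : q ≤ 1) (g : ℝ) :
    QQ α q g ≤ 32 * (1 + g ^ 2) := by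
  unfold QQ Qv
  have h2 : (1 + g + α * g) ^ 2 ≤ 32 * (1 + g ^ 2) := by
    nlinarith [sq_nonneg (1 - (1 + α) * g), mul_nonneg (sq_nonneg g)
      (mul_nonneg (by linarith : 0 ≤ 3 - α) (by linarith : 0 ≤ 5 + α))]
  have h3 : (1 + g - α * g) ^ 2 ≤ 32 * (1 + g ^ 2) := by
    nlinarith [sq_nonneg (1 - (1 - α) * g), mul_nonneg (sq_nonneg g)
      (mul_nonneg (by linarith : 0 ≤ 3 - α) (by linarith : 0 ≤ 1 + α)), sq_nonneg g]
  nlinarith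

theorem ss_nonneg (h0 : 0 ≤ q) (h1 : q ≤ 1) (N : ℕ) : 0 ≤ ss α q N :=
  Finset.sum_nonneg fun _ _ => QQ_nonneg h0 h1 _

theorem sum_ee_le (h0 : 0 ≤ q) (h1 : q ≤ 1) {N k : ℕ} (hk : 1 ≤ k) :
    ∑ j ∈ Finset.Ico k N, ee α q N (j + 1) ^ 2 ≤ ss α q N := by
  unfold ss
  calc ∑ j ∈ Finset.Ico k N, ee α q N (j + 1) ^ 2
      ≤ ∑ j ∈ Finset.Ico k N, QQ α q (gg α q N (j + 1)) := by
        refine Finset.sum_le_sum fun j hj => QQ_ge h0 h1 ?_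
        have := (Finset.mem_Ico.1 hj).2
        omega
    _ ≤ _ := by
        refine Finset.sum_le_sum_of_subset_of_nonneg (Finset.Ico_subset_Ico_left hk) ?_
        intro _ _ _; exact QQ_nonneg h0 h1 _

theorem sum_inv_zz (ha : -1 / 2 ≤ α) {k : ℕ} (hk : 1 ≤ k) (N : ℕ) :
    ∑ j ∈ Finset.Ico k N, (1 / zz α j) ^ 2 ≤ 4 / (k : ℝ) := by
  have hk' : (1 : ℝ) ≤ k := by exact_mod_cast hk
  rcases le_or_gt k N with h | h
  · suffices ∑ j ∈ Finset.Ico k N, (1 / zz α j) ^ 2 ≤ 4 / (k : ℝ) - 4 / (N : ℝ) by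
      have : 0 ≤ 4 / (N : ℝ) := by positivity
      linarith
    induction N, h using Nat.le_induction with
    | base => simp
    | succ n hn ih =>
      rw [Finset.sum_Ico_succ_top hn]
      have hn1 : 1 ≤ n := hk.trans hn
      have hn' : (1 : ℝ) ≤ n := by exact_mod_cast hn1
      have hz := zz_ge ha hn1
      have : (1 / zz α n) ^ 2 ≤ 4 / (n : ℝ) - 4 / ((n + 1 : ℕ) : ℝ) := by
        push_cast
        have e : 4 / (n : ℝ) - 4 / ((n : ℝ) + 1) = 4 / (n * (n + 1)) := by field_simp; ring
        rw [e, div_pow, div_le_div_iff₀ (by nlinarith) (by positivity)]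
        nlinarith
      linarith
  · rw [Finset.Ico_eq_empty (by omega)]; simp only [Finset.sum_empty]; positivity

theorem gg_sq_le (ha : -1 / 2 ≤ α) (h0 : 0 ≤ q) (h1 : q ≤ 1) {N k : ℕ} (hk : 1 ≤ k) :
    gg α q N k ^ 2 ≤ ss α q N * (4 / (k : ℝ)) := by
  have := Finset.sum_mul_sq_le_sq_mul_sq (Finset.Ico k N) (fun j => ee α q N (j + 1))
    (fun j => 1 / zz α j)
  have e : gg α q N k = ∑ j ∈ Finset.Ico k N, ee α q N (j + 1) * (1 / zz α j) := by
    unfold gg; simp only [mul_one_div]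
  rw [e]
  refine this.trans ?_
  exact mul_le_mul (sum_ee_le h0 h1 hk) (sum_inv_zz ha hk N)
    (Finset.sum_nonneg fun _ _ => sq_nonneg _) (ss_nonneg h0 h1 N)

theorem ss_tendsto (ha : -1 / 2 ≤ α) (h0 : 0 ≤ q) (h1 : q ≤ 1) :
    Tendsto (ss α q) atTop atTop := by
  have hc : ContinuousAt (QQ α q) 0 := by
    apply Continuous.continuousAt
    unfold QQ Qv
    fun_prop
  have hQ0 : (1 / 2 : ℝ) < QQ α q 0 := by norm_num [QQ, Qv]
  obtain ⟨δ, hδ, hδ'⟩ := Metric.eventually_nhds_iff.1 (hc.eventually (lt_mem_nhds hQ0))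
  rw [tendsto_atTop]
  intro B
  wlog hB : 0 < B generalizing B
  · filter_upwards [this 1 one_pos] with N hN
    linarith
  obtain ⟨K, hK⟩ := exists_nat_gt (4 * B / δ ^ 2 + 1)
  filter_upwards [eventually_ge_atTop (K + 1 + ⌈2 * B⌉₊)] with N hN
  by_contra hlt
  push Not at hlt
  have hpos : 0 < 4 * B / δ ^ 2 := by positivity
  have hK1 : (1 : ℝ) < K := by linarith
  have hK1' : 1 ≤ K := by exact_mod_cast hK1.le
  have h2 : ∀ k ∈ Finset.Ico K N, (1 / 2 : ℝ) ≤ QQ α q (gg α q N (k + 1)) := by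
    intro k hk
    have hk' := Finset.mem_Ico.1 hk
    refine (hδ' ?_).le
    rw [Real.dist_eq, sub_zero]
    apply abs_lt_of_sq_lt_sq _ hδ.le
    refine (gg_sq_le ha h0 h1 (by omega)).trans_lt ?_
    have hkk : (K : ℝ) < ((k + 1 : ℕ) : ℝ) := by exact_mod_cast (by omega : K < k + 1)
    have hk0 : (0 : ℝ) < ((k + 1 : ℕ) : ℝ) := by positivity
    have : 4 * B / δ ^ 2 < ((k + 1 : ℕ) : ℝ) := by linarith
    rw [div_lt_iff₀ (by positivity)] at this
    rw [mul_div_assoc', div_lt_iff₀ hk0]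
    nlinarith
  have h3 : ∑ k ∈ Finset.Ico K N, (1 / 2 : ℝ) ≤ ss α q N := by
    refine (Finset.sum_le_sum h2).trans ?_
    unfold ss
    refine Finset.sum_le_sum_of_subset_of_nonneg (Finset.Ico_subset_Ico_left hK1') ?_
    intro _ _ _; exact QQ_nonneg h0 h1 _
  simp only [Finset.sum_const, Nat.card_Ico, nsmul_eq_mul] at h3
  have h4 : 2 * B ≤ ((N - K : ℕ) : ℝ) := by
    refine (Nat.le_ceil _).trans ?_
    exact_mod_cast (by omega : ⌈2 * B⌉₊ ≤ N - K)
  linarith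

theorem ee_mono_step (ha : -1 / 2 ≤ α) (h1 : q ≤ 1) (hq : (α + 1) / 4 ≤ q)
    {N k : ℕ} (hk : 2 ≤ k) (hN : k < N) :
    (zz α k - (1 + α) / 4) * ee α q N k ^ 2 ≤
      (zz α (k + 1) - (1 + α) / 4) * ee α q N (k + 1) ^ 2 := by
  rw [ee_rec hN, zz_succ]
  have hz := zz_ge ha (by omega : 1 ≤ k)
  have hk' : (2 : ℝ) ≤ k := by exact_mod_cast hk
  have hz1 : (3 / 2 : ℝ) ≤ zz α k := by linarith
  set z := zz α k
  set e := ee α q N (k + 1)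
  have ha3 : α ≤ 3 := by linarith
  have hz0 : 0 < z := by linarith
  have hA : 0 < 1 + α := by linarith
  have hsq : (z + (1 + α - 2 * q)) ^ 2 ≤ (z + (1 + α) / 2) ^ 2 := by
    apply sq_le_sq'
    · linarith
    · linarith
  have hy : 0 ≤ z - (1 + α) / 4 := by linarith
  have hfac : (z - (1 + α) / 4) * (1 + (1 + α - 2 * q) / z) ^ 2 ≤ z + (1 + α) - (1 + α) / 4 := by
    have : (1 + (1 + α - 2 * q) / z) = (z + (1 + α - 2 * q)) / z := by field_simp
    rw [this, div_pow, mul_div_assoc', div_le_iff₀ (by positivity)]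
    refine (mul_le_mul_of_nonneg_left hsq hy).trans ?_
    have : 0 < (1 + α) ^ 3 := by positivity
    nlinarith
  calc _ = ((z - (1 + α) / 4) * (1 + (1 + α - 2 * q) / z) ^ 2) * e ^ 2 := by ring
    _ ≤ _ := mul_le_mul_of_nonneg_right hfac (sq_nonneg _)

theorem ee_mono (ha : -1 / 2 ≤ α) (h1 : q ≤ 1) (hq : (α + 1) / 4 ≤ q)
    {N k l : ℕ} (hk : 2 ≤ k) (hl : k ≤ l) (hN : l ≤ N) :
    (zz α k - (1 + α) / 4) * ee α q N k ^ 2 ≤ (zz α l - (1 + α) / 4) * ee α q N l ^ 2 := by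
  induction l, hl using Nat.le_induction with
  | base => exact le_rfl
  | succ n hn ih =>
    exact (ih (by omega)).trans (ee_mono_step ha h1 hq (by omega) (by omega))

theorem ee_tendsto (ha : -1 / 2 ≤ α) (h0 : 0 ≤ q) (h1 : q ≤ 1) (hq : (α + 1) / 4 ≤ q)
    {k : ℕ} (hk : 2 ≤ k) :
    Tendsto (fun N => ee α q N k ^ 2 / ss α q N) atTop (nhds 0) := by
  have ha3 : α ≤ 3 := by linarith
  set y := zz α k - (1 + α) / 4 with hy
  have hy0 : 0 < y := by
    have hk' : (2 : ℝ) ≤ k := by exact_mod_cast hk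
    rw [hy]; unfold zz; nlinarith
  -- the harmonic tail
  have hH : Tendsto (fun N => ∑ j ∈ Finset.range N, (1 : ℝ) / (((j + k : ℕ) : ℝ))) atTop atTop := by
    have := (summable_nat_add_iff (f := fun n : ℕ => (1 : ℝ) / (n : ℝ)) k).not.2
      Real.not_summable_one_div_natCast
    exact (not_summable_iff_tendsto_nat_atTop_of_nonneg (fun _ => by positivity)).1 this
  have hH' : Tendsto (fun N => ∑ j ∈ Finset.range (N - k), (1 : ℝ) / (((j + k : ℕ) : ℝ)))
      atTop atTop := hH.comp (tendsto_sub_atTop_nat k)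
  have hb : ∀ N, k ≤ N → (y / 4) * ee α q N k ^ 2 *
      (∑ j ∈ Finset.range (N - k), (1 : ℝ) / (((j + k : ℕ) : ℝ))) ≤ ss α q N := by
    intro N hN
    refine le_trans ?_ (sum_ee_le h0 h1 (by omega : 1 ≤ k - 1))
    rw [Finset.mul_sum]
    calc ∑ j ∈ Finset.range (N - k), y / 4 * ee α q N k ^ 2 * ((1 : ℝ) / (((j + k : ℕ) : ℝ)))
        ≤ ∑ j ∈ Finset.range (N - k), ee α q N (j + k) ^ 2 := by
          refine Finset.sum_le_sum fun j hj => ?_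
          have hj' := Finset.mem_range.1 hj
          have hm := ee_mono ha h1 hq hk (by omega : k ≤ j + k) (by omega : j + k ≤ N)
          have hl0 : (0 : ℝ) < ((j + k : ℕ) : ℝ) := by
            exact_mod_cast (by omega : 0 < j + k)
          have hyl : zz α (j + k) - (1 + α) / 4 ≤ 4 * ((j + k : ℕ) : ℝ) := by
            have : (1 : ℝ) ≤ ((j + k : ℕ) : ℝ) := by exact_mod_cast (by omega : 1 ≤ j + k)
            unfold zz; nlinarith
          have := mul_le_mul_of_nonneg_right hyl (sq_nonneg (ee α q N (j + k)))
          rw [mul_one_div, div_le_iff₀ hl0]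
          nlinarith
      _ = ∑ j ∈ Finset.Ico (k - 1) (N - 1), ee α q N (j + 1) ^ 2 := by
          rw [Finset.sum_Ico_eq_sum_range]
          have : N - 1 - (k - 1) = N - k := by omega
          rw [this]
          refine Finset.sum_congr rfl fun j _ => ?_
          have : k - 1 + j + 1 = j + k := by omega
          rw [this]
      _ ≤ _ := by
          refine Finset.sum_le_sum_of_subset_of_nonneg
            (Finset.Ico_subset_Ico_right (by omega)) ?_
          intro _ _ _; exact sq_nonneg _
  have hlim : Tendsto (fun N => (4 / y) *
      (∑ j ∈ Finset.range (N - k), (1 : ℝ) / (((j + k : ℕ) : ℝ)))⁻¹) atTop (nhds 0) := by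
    simpa using (tendsto_inv_atTop_zero.comp hH').const_mul (4 / y)
  refine squeeze_zero' (Filter.Eventually.of_forall fun N => ?_) ?_ hlim
  · exact div_nonneg (sq_nonneg _) (ss_nonneg h0 h1 N)
  · filter_upwards [eventually_ge_atTop k, hH'.eventually_gt_atTop 0,
      (ss_tendsto ha h0 h1).eventually_gt_atTop 0] with N hN hpos hs
    have := hb N hN
    set H := ∑ j ∈ Finset.range (N - k), (1 : ℝ) / (((j + k : ℕ) : ℝ))
    rw [div_le_iff₀ hs, ← div_eq_mul_inv, div_div, div_mul_eq_mul_div, le_div_iff₀ (by positivity)]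
    nlinarith

theorem gg_tendsto (ha : -1 / 2 ≤ α) (h0 : 0 ≤ q) (h1 : q ≤ 1) (hq : (α + 1) / 4 ≤ q)
    {k : ℕ} (hk : 1 ≤ k) :
    Tendsto (fun N => |gg α q N k| / Real.sqrt (ss α q N)) atTop (nhds 0) := by
  have hsplit : ∀ N n, k + n ≤ N → |gg α q N k| ≤
      ∑ j ∈ Finset.Ico k (k + n), |ee α q N (j + 1)| / zz α j + |gg α q N (k + n)| := by
    intro N n
    induction n with
    | zero => intro _; simp
    | succ n ih =>
      intro h
      rw [← add_assoc, Finset.sum_Ico_succ_top (by omega)]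
      have h2 := ih (by omega)
      rw [gg_rec (by omega : k + n < N)] at h2
      have h3 := abs_add_le (gg α q N (k + n + 1)) (ee α q N (k + n + 1) / zz α (k + n))
      rw [abs_div, abs_of_pos (a := zz α (k + n))
        (by linarith [zz_ge_one ha (by omega : 1 ≤ k + n)])] at h3
      linarith
  have hlim : ∀ n, Tendsto (fun N => ∑ j ∈ Finset.Ico k (k + n),
      Real.sqrt (ee α q N (j + 1) ^ 2 / ss α q N) / zz α j) atTop (nhds 0) := by
    intro n
    have : (0 : ℝ) = ∑ j ∈ Finset.Ico k (k + n), 0 := by simp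
    rw [this]
    refine tendsto_finsetSum _ fun j hj => ?_
    have hj' := Finset.mem_Ico.1 hj
    have := (ee_tendsto ha h0 h1 hq (by omega : 2 ≤ j + 1)).sqrt.div_const (zz α j)
    simpa using this
  rw [Metric.tendsto_nhds]
  intro ε hε
  obtain ⟨n, hn⟩ := exists_nat_gt (16 / ε ^ 2)
  filter_upwards [(hlim n).eventually (gt_mem_nhds (half_pos hε)), eventually_ge_atTop (k + n),
    (ss_tendsto ha h0 h1).eventually_gt_atTop 0] with N hN1 hN2 hs
  have hsq : 0 < Real.sqrt (ss α q N) := Real.sqrt_pos.2 hs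
  rw [Real.dist_eq, sub_zero, abs_of_nonneg (by positivity), div_lt_iff₀ hsq]
  refine (hsplit N n hN2).trans_lt ?_
  have e1 : ∑ j ∈ Finset.Ico k (k + n), |ee α q N (j + 1)| / zz α j =
      (∑ j ∈ Finset.Ico k (k + n),
        Real.sqrt (ee α q N (j + 1) ^ 2 / ss α q N) / zz α j) * Real.sqrt (ss α q N) := by
    rw [Finset.sum_mul]
    refine Finset.sum_congr rfl fun j _ => ?_
    rw [Real.sqrt_div (sq_nonneg _), Real.sqrt_sq_eq_abs]
    field_simp
  have e2 : |gg α q N (k + n)| ≤ ε / 2 * Real.sqrt (ss α q N) := by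
    apply abs_le_of_sq_le_sq' _ (by positivity) |>.2
    rw [sq_abs, mul_pow, Real.sq_sqrt hs.le]
    refine (gg_sq_le ha h0 h1 (by omega)).trans ?_
    rw [mul_comm]
    refine mul_le_mul_of_nonneg_right ?_ hs.le
    have hn0 : (0 : ℝ) < n := lt_trans (by positivity) hn
    have hkn : (0 : ℝ) < ((k + n : ℕ) : ℝ) := by push_cast; positivity
    rw [div_le_iff₀ hkn]
    rw [div_lt_iff₀ (by positivity)] at hn
    push_cast
    have : 0 ≤ (k : ℝ) * ε ^ 2 := by positivity
    nlinarith
  rw [e1]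
  nlinarith

theorem toeplitz (w : ℕ → ℕ → ℝ) (f : ℕ → ℝ) (hw : ∀ N k, 0 ≤ w N k)
    (hs : ∀ᶠ N in atTop, ∑ k ∈ Finset.Ico 1 N, w N k ≤ 1)
    (hk : ∀ k, 1 ≤ k → Tendsto (fun N => w N k) atTop (nhds 0))
    (hf : ∀ k, 0 ≤ f k) (hf0 : Tendsto f atTop (nhds 0)) :
    Tendsto (fun N => ∑ k ∈ Finset.Ico 1 N, w N k * f k) atTop (nhds 0) := by
  rw [Metric.tendsto_nhds]
  intro ε hε
  obtain ⟨K, hK⟩ := eventually_atTop.1 (hf0.eventually (gt_mem_nhds (half_pos hε)))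
  have hlim : Tendsto (fun N => ∑ k ∈ Finset.Ico 1 (K + 1), w N k * f k) atTop (nhds 0) := by
    have : (0 : ℝ) = ∑ k ∈ Finset.Ico 1 (K + 1), 0 := by simp
    rw [this]
    refine tendsto_finsetSum _ fun j hj => ?_
    simpa using (hk j (Finset.mem_Ico.1 hj).1).mul_const (f j)
  filter_upwards [hs, hlim.eventually (gt_mem_nhds (half_pos hε)), eventually_ge_atTop (K + 1)]
    with N h1 h2 h3
  rw [Real.dist_eq, sub_zero, abs_of_nonneg (Finset.sum_nonneg fun k _ =>
    mul_nonneg (hw N k) (hf k))]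
  rw [← Finset.sum_Ico_consecutive _ (by omega : 1 ≤ K + 1) h3]
  have h4 : ∑ k ∈ Finset.Ico (K + 1) N, w N k * f k ≤ ε / 2 := by
    calc ∑ k ∈ Finset.Ico (K + 1) N, w N k * f k
        ≤ ∑ k ∈ Finset.Ico (K + 1) N, w N k * (ε / 2) := by
          refine Finset.sum_le_sum fun k hk' => mul_le_mul_of_nonneg_left ?_ (hw N k)
          exact (hK k (by have := (Finset.mem_Ico.1 hk').1; omega)).le
      _ = (∑ k ∈ Finset.Ico (K + 1) N, w N k) * (ε / 2) := by rw [Finset.sum_mul]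
      _ ≤ 1 * (ε / 2) := by
          refine mul_le_mul_of_nonneg_right (le_trans ?_ h1) (by positivity)
          exact Finset.sum_le_sum_of_subset_of_nonneg
            (Finset.Ico_subset_Ico_left (by omega)) fun _ _ _ => hw N _
      _ = ε / 2 := one_mul _
  linarith

end det
section clt

variable {α q : ℝ} {Ω : Type} [mΩ : MeasurableSpace Ω] (P : VSIProcess α q Ω)

theorem pvs_eq {n : ℕ} (hn : 1 ≤ n) (x y : ℤ) :
    2 * pvs α n x y - 1 = ((x : ℝ) + α * y) / zz α n := by
  have hn' : (n : ℝ) ≠ 0 := by positivity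
  have : Zvs α n * n = zz α n := by unfold Zvs zz; field_simp; ring
  unfold pvs
  rw [this]; ring

noncomputable def UU (n : ℕ) : ℝ := ∫ ω, (((P.Δ n ω).1 : ℝ) + α * (P.Δ n ω).2) ^ 2 ∂P.μ

theorem UU_nonneg (n : ℕ) : 0 ≤ UU P n := integral_nonneg fun _ => sq_nonneg _

theorem UU_one : UU P 1 = 1 := by
  have := P.isProb
  unfold UU
  simp [P.init]

theorem UU_step {n : ℕ} (hn : 1 ≤ n) :
    UU P (n + 1) = UU P n * (1 + 2 * (1 + α - 2 * q) / zz α n) + Qv q 1 α := by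
  have := P.isProb
  have h := VSI_step P hn (fun x : ℤ × ℤ => ((x.1 : ℝ) + α * x.2) ^ 2)
  unfold UU
  rw [h]
  have hi := VSI_integrable P hn (fun x : ℤ × ℤ => ((x.1 : ℝ) + α * x.2) ^ 2)
  trans ∫ ω, ((((P.Δ n ω).1 : ℝ) + α * (P.Δ n ω).2) ^ 2 *
      (1 + 2 * (1 + α - 2 * q) / zz α n) + Qv q 1 α) ∂P.μ
  · congr 1
    funext ω
    have hp := pvs_eq (α := α) hn (P.Δ n ω).1 (P.Δ n ω).2
    have hp' : pvs α n (P.Δ n ω).1 (P.Δ n ω).2 =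
      (1 + (((P.Δ n ω).1 : ℝ) + α * (P.Δ n ω).2) / zz α n) / 2 := by linarith
    simp only [hp', smul_eq_mul, Prod.fst_add, Prod.snd_add, Qv]
    push_cast
    ring
  · rw [integral_add (hi.mul_const _) (integrable_const _), integral_mul_const]
    simp

theorem UU_le (ha : -1 / 2 ≤ α) (h0 : 0 ≤ q) (h1 : q ≤ 1) (hq : (α + 1) / 4 ≤ q)
    {n : ℕ} (hn : 1 ≤ n) :
    UU P n / zz α n ≤ 1 + Qv q 1 α * ∑ j ∈ Finset.range n, 1 / zz α (j + 1) := by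
  have hs : 0 ≤ Qv q 1 α := Qv_nonneg h0 h1 _ _
  induction n, hn using Nat.le_induction with
  | base =>
    rw [UU_one]
    simp [zz]
    linarith
  | succ n hn ih =>
    have hz := zz_ge_one ha hn
    have hz' := zz_ge_one ha (by omega : 1 ≤ n + 1)
    rw [UU_step P hn, Finset.sum_range_succ]
    have hA : UU P n * (1 + 2 * (1 + α - 2 * q) / zz α n) / zz α (n + 1) ≤ UU P n / zz α n := by
      have hU := UU_nonneg P n
      rw [div_le_div_iff₀ (by linarith) (by linarith)]
      have e : UU P n * (1 + 2 * (1 + α - 2 * q) / zz α n) * zz α n =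
        UU P n * (zz α n + 2 * (1 + α - 2 * q)) := by field_simp
      rw [e]
      apply mul_le_mul_of_nonneg_left _ hU
      rw [zz_succ]; linarith
    rw [add_div]
    have e2 : Qv q 1 α / zz α (n + 1) = Qv q 1 α * (1 / zz α (n + 1)) := by ring
    rw [e2, mul_add (Qv q 1 α)]
    linarith

theorem inv_zz_tendsto (ha : -1 / 2 ≤ α) :
    Tendsto (fun j : ℕ => 1 / zz α (j + 1)) atTop (nhds 0) := by
  have hlim : Tendsto (fun j : ℕ => 2 * (1 / ((j : ℝ) + 1))) atTop (nhds 0) := by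
    simpa using (tendsto_one_div_add_atTop_nhds_zero_nat (𝕜 := ℝ)).const_mul 2
  refine squeeze_zero (fun j => ?_) (fun j => ?_) hlim
  · have := zz_ge_one ha (by omega : 1 ≤ j + 1)
    positivity
  · have h := zz_ge ha (by omega : 1 ≤ j + 1)
    have h1 := zz_ge_one ha (by omega : 1 ≤ j + 1)
    push_cast at h
    rw [mul_one_div, div_le_div_iff₀ (by linarith) (by positivity)]
    linarith

theorem UU_tendsto (ha : -1 / 2 ≤ α) (h0 : 0 ≤ q) (h1 : q ≤ 1) (hq : (α + 1) / 4 ≤ q) :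
    Tendsto (fun n => UU P n / zz α n ^ 2) atTop (nhds 0) := by
  have hs : 0 ≤ Qv q 1 α := Qv_nonneg h0 h1 _ _
  have hc := (inv_zz_tendsto ha).cesaro
  have hlim : Tendsto (fun n : ℕ => 2 * (1 / (n : ℝ)) + 2 * Qv q 1 α *
      ((n : ℝ)⁻¹ * ∑ j ∈ Finset.range n, 1 / zz α (j + 1))) atTop (nhds 0) := by
    simpa using ((tendsto_one_div_atTop_nhds_zero_nat (𝕜 := ℝ)).const_mul 2).add
      (hc.const_mul (2 * Qv q 1 α))
  refine squeeze_zero' (Filter.Eventually.of_forall fun n => ?_) ?_ hlim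
  · exact div_nonneg (UU_nonneg P n) (sq_nonneg _)
  · filter_upwards [eventually_ge_atTop 1] with n hn
    have hb := UU_le P ha h0 h1 hq hn
    have hz := zz_ge ha hn
    have hz1 := zz_ge_one ha hn
    have hn' : (1 : ℝ) ≤ n := by exact_mod_cast hn
    have hS : 0 ≤ ∑ j ∈ Finset.range n, 1 / zz α (j + 1) := Finset.sum_nonneg fun j _ => by
      have := zz_ge_one ha (by omega : 1 ≤ j + 1)
      positivity
    set S := ∑ j ∈ Finset.range n, 1 / zz α (j + 1)
    have e : UU P n / zz α n ^ 2 = UU P n / zz α n / zz α n := by rw [div_div, sq]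
    have e2 : 2 * (1 / (n : ℝ)) + 2 * Qv q 1 α * ((n : ℝ)⁻¹ * S) =
      (1 + Qv q 1 α * S) * (2 / n) := by field_simp
    rw [e, e2, div_eq_mul_one_div]
    refine mul_le_mul hb ?_ (by positivity) (by positivity)
    rw [div_le_div_iff₀ (by linarith) (by linarith)]
    linarith

/-- The test function `exp(i τ (x₁ (1+g) + α g x₂))`. -/
noncomputable def Phi (α τ g : ℝ) (x : ℤ × ℤ) : ℂ :=
  Complex.exp ((τ * (x.1 * (1 + g) + α * g * x.2) : ℝ) * Complex.I)

noncomputable def Ch (N : ℕ) (τ : ℝ) (k : ℕ) : ℂ :=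
  ∫ ω, Phi α τ (gg α q N k) (P.Δ k ω) ∂P.μ

theorem Phi_step (h0 : 0 < q) (h1 : q ≤ 1) {κ : ℝ}
    (hk : 0 < κ) (hk1 : κ ≤ 1) (hkq : q = 0 ∨ κ ≤ q) (hkq' : 1 - q = 0 ∨ κ ≤ 1 - q)
    {τ g g' z p v : ℝ} (hg : g = g' + ((1 - 2 * q) + (1 + α - 2 * q) * g') / z)
    (x : ℤ × ℤ) (hp0 : 0 ≤ p) (hp1 : p ≤ 1) (hp : 2 * p - 1 = ((x.1 : ℝ) + α * x.2) / z)
    (hv : v = τ ^ 2 * QQ α q g') :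
    ‖((p * (1 - q)) • Phi α τ g' (x + (1, 1)) + (p * q) • Phi α τ g' (x + (-1, 1)) +
      ((1 - p) * q) • Phi α τ g' (x + (1, -1)) +
      ((1 - p) * (1 - q)) • Phi α τ g' (x + (-1, -1))) -
      Phi α τ g x * ((Real.exp (-v / 2) : ℝ) : ℂ)‖ ≤
      ((x.1 : ℝ) + α * x.2) ^ 2 * (v / z ^ 2) + (64 / κ ^ 3 * Real.sqrt v ^ 3 + v ^ 2) := by
  have hQv : Qv q (τ * (1 + g')) (τ * (α * g')) = v := by
    rw [hv]; unfold QQ Qv; ring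
  have ho := aux_onestep (a := τ * (1 + g')) (b := τ * (α * g')) hp0 hp1 h0.le h1 hk hk1
    hkq hkq' _ rfl
  rw [hQv] at ho
  obtain ⟨m, hm⟩ : ∃ m, m = (2 * p - 1) * ((1 - 2 * q) * (τ * (1 + g')) + τ * (α * g')) :=
    ⟨_, rfl⟩
  rw [← hm] at ho
  obtain ⟨M, hM⟩ : ∃ M, M = τ * (x.1 * (1 + g) + α * g * x.2) := ⟨_, rfl⟩
  have hmM : M = τ * (x.1 * (1 + g') + α * g' * x.2) + m := by
    rw [hm, hp, hM, hg]; ring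
  have hsp : ∀ (y : ℤ × ℤ) (u : ℝ), τ * (y.1 * (1 + g') + α * g' * y.2) = M + u →
      Phi α τ g' y = Complex.exp (M * Complex.I) * Complex.exp (u * Complex.I) := by
    intro y u h
    unfold Phi
    rw [h, ← Complex.exp_add]; congr 1; push_cast; ring
  have s1 := hsp (x + (1, 1)) (τ * (1 + g') + τ * (α * g') - m) (by
    rw [hmM]; simp only [Prod.fst_add, Prod.snd_add]; push_cast; ring)
  have s2 := hsp (x + (-1, 1)) (-(τ * (1 + g')) + τ * (α * g') - m) (by
    rw [hmM]; simp only [Prod.fst_add, Prod.snd_add]; push_cast; ring)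
  have s3 := hsp (x + (1, -1)) (τ * (1 + g') - τ * (α * g') - m) (by
    rw [hmM]; simp only [Prod.fst_add, Prod.snd_add]; push_cast; ring)
  have s4 := hsp (x + (-1, -1)) (-(τ * (1 + g')) - τ * (α * g') - m) (by
    rw [hmM]; simp only [Prod.fst_add, Prod.snd_add]; push_cast; ring)
  have s5 : Phi α τ g x = Complex.exp (M * Complex.I) := by unfold Phi; rw [hM]
  have hnorm : ‖Complex.exp ((M : ℂ) * Complex.I)‖ = 1 := Complex.norm_exp_ofReal_mul_I M
  have hfin : (2 * p - 1) ^ 2 * v + 64 / κ ^ 3 * Real.sqrt v ^ 3 + v ^ 2 =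
      (((x.1 : ℝ) + α * x.2) ^ 2 * (v / z ^ 2) + (64 / κ ^ 3 * Real.sqrt v ^ 3 + v ^ 2)) := by
    rw [hp]; ring
  rw [hfin] at ho
  refine le_trans (le_of_eq ?_) ho
  rw [s1, s2, s3, s4, s5]
  simp only [Complex.real_smul]
  generalize Complex.exp ((M : ℂ) * Complex.I) = E at *
  generalize Complex.exp (((τ * (1 + g') + τ * (α * g') - m : ℝ) : ℂ) * Complex.I) = E1
  generalize Complex.exp (((-(τ * (1 + g')) + τ * (α * g') - m : ℝ) : ℂ) * Complex.I) = E2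
  generalize Complex.exp (((τ * (1 + g') - τ * (α * g') - m : ℝ) : ℂ) * Complex.I) = E3
  generalize Complex.exp (((-(τ * (1 + g')) - τ * (α * g') - m : ℝ) : ℂ) * Complex.I) = E4
  generalize ((Real.exp (-v / 2) : ℝ) : ℂ) = E5
  rw [← one_mul (‖_ - E5‖), ← hnorm, ← norm_mul]
  congr 1
  ring

theorem Ch_step (h0 : 0 < q) (h1 : q ≤ 1) {κ : ℝ}
    (hk : 0 < κ) (hk1 : κ ≤ 1) (hkq : q = 0 ∨ κ ≤ q) (hkq' : 1 - q = 0 ∨ κ ≤ 1 - q)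
    {N k : ℕ} (hk0 : 1 ≤ k) (hN : k < N) (τ : ℝ) :
    ‖Ch P N τ (k + 1) - Ch P N τ k *
      (Real.exp (-(τ ^ 2 * QQ α q (gg α q N (k + 1))) / 2) : ℝ)‖ ≤
      τ ^ 2 * QQ α q (gg α q N (k + 1)) * (UU P k / zz α k ^ 2) +
      (64 / κ ^ 3 * Real.sqrt (τ ^ 2 * QQ α q (gg α q N (k + 1))) ^ 3 +
      (τ ^ 2 * QQ α q (gg α q N (k + 1))) ^ 2) := by
  have := P.isProb
  obtain ⟨g', hg'⟩ : ∃ g', g' = gg α q N (k + 1) := ⟨_, rfl⟩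
  obtain ⟨g, hg⟩ : ∃ g, g = gg α q N k := ⟨_, rfl⟩
  have hgk : g = g' + ((1 - 2 * q) + (1 + α - 2 * q) * g') / zz α k := by
    rw [hg, gg_rec hN, ee_eq N (N - (k + 1)) (k + 1) (by omega), hg']
  unfold Ch
  rw [← hg', ← hg]
  obtain ⟨v, hv⟩ : ∃ v, v = τ ^ 2 * QQ α q g' := ⟨_, rfl⟩
  rw [← hv]
  have hpt := fun (x : ℤ × ℤ) (p : ℝ) => Phi_step h0 h1 hk hk1 hkq hkq' (p := p) hgk x
    (hv := hv)
  generalize Phi α τ g' = Φ' at *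
  generalize Phi α τ g = Φ at *
  rw [VSI_step P hk0 Φ', ← integral_mul_const, ← integral_sub]
  rotate_left
  · exact VSI_integrable P hk0 (fun x : ℤ × ℤ =>
      ((pvs α k x.1 x.2 * (1 - q)) • Φ' (x + (1, 1)) +
      (pvs α k x.1 x.2 * q) • Φ' (x + (-1, 1)) +
      ((1 - pvs α k x.1 x.2) * q) • Φ' (x + (1, -1)) +
      ((1 - pvs α k x.1 x.2) * (1 - q)) • Φ' (x + (-1, -1))))
  · exact VSI_integrable P hk0 (fun x : ℤ × ℤ => Φ x * ((Real.exp (-v / 2) : ℝ) : ℂ))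
  refine (norm_integral_le_integral_norm _).trans ?_
  have hi := VSI_integrable P hk0 (fun x : ℤ × ℤ => ((x.1 : ℝ) + α * x.2) ^ 2)
  generalize 64 / κ ^ 3 * Real.sqrt v ^ 3 + v ^ 2 = R at *
  have hI : ∫ ω, ((((P.Δ k ω).1 : ℝ) + α * (P.Δ k ω).2) ^ 2 * (v / zz α k ^ 2) + R) ∂P.μ =
      v * (UU P k / zz α k ^ 2) + R := by
    rw [integral_add (hi.mul_const _) (integrable_const _), integral_mul_const]
    unfold UU
    simp
    ring
  rw [← hI]
  refine integral_mono_of_nonneg (Filter.Eventually.of_forall fun ω => norm_nonneg _)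
    ((hi.mul_const _).add (integrable_const _)) ?_
  filter_upwards [VSI_prob P hk0] with ω hω
  exact hpt (P.Δ k ω) _ hω.1 hω.2 (pvs_eq hk0 _ _)

theorem telescope (A : ℕ → ℂ) (v err : ℕ → ℝ) (N : ℕ) (hv : ∀ k, 0 ≤ v k)
    (h : ∀ k, 1 ≤ k → k < N → ‖A (k + 1) - A k * (Real.exp (-(v k) / 2) : ℝ)‖ ≤ err k)
    (n : ℕ) (hn : 1 ≤ n) (hnN : n ≤ N) :
    ‖A n - A 1 * (Real.exp (-(∑ k ∈ Finset.Ico 1 n, v k) / 2) : ℝ)‖ ≤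
      ∑ k ∈ Finset.Ico 1 n, err k := by
  induction n, hn using Nat.le_induction with
  | base => simp
  | succ n hn ih =>
    rw [Finset.sum_Ico_succ_top hn, Finset.sum_Ico_succ_top hn]
    have h1 := h n hn (by omega)
    have h2 := ih (by omega)
    have e : A (n + 1) - A 1 *
        (Real.exp (-(∑ k ∈ Finset.Ico 1 n, v k + v n) / 2) : ℝ) =
        (A n - A 1 * (Real.exp (-(∑ k ∈ Finset.Ico 1 n, v k) / 2) : ℝ)) *
          (Real.exp (-(v n) / 2) : ℝ) + (A (n + 1) - A n * (Real.exp (-(v n) / 2) : ℝ)) := by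
      have : Real.exp (-(∑ k ∈ Finset.Ico 1 n, v k + v n) / 2) =
        Real.exp (-(∑ k ∈ Finset.Ico 1 n, v k) / 2) * Real.exp (-(v n) / 2) := by
        rw [← Real.exp_add]; congr 1; ring
      rw [this]; push_cast; ring
    rw [e]
    refine (norm_add_le _ _).trans (add_le_add ?_ h1)
    rw [norm_mul]
    have h3 : ‖((Real.exp (-(v n) / 2) : ℝ) : ℂ)‖ ≤ 1 := by
      rw [Complex.norm_real, Real.norm_of_nonneg (Real.exp_pos _).le]
      exact Real.exp_le_one_iff.2 (by linarith [hv n])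
    calc _ ≤ ‖A n - A 1 * (Real.exp (-(∑ k ∈ Finset.Ico 1 n, v k) / 2) : ℝ)‖ * 1 :=
          mul_le_mul_of_nonneg_left h3 (norm_nonneg _)
      _ ≤ _ := by rw [mul_one]; exact h2

end clt
section final

variable {α q : ℝ} {Ω : Type} [mΩ : MeasurableSpace Ω] (P : VSIProcess α q Ω)

noncomputable def ww (α q : ℝ) (N k : ℕ) : ℝ := QQ α q (gg α q N (k + 1)) / ss α q N

theorem ww_nonneg (h0 : 0 ≤ q) (h1 : q ≤ 1) (N k : ℕ) : 0 ≤ ww α q N k :=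
  div_nonneg (QQ_nonneg h0 h1 _) (ss_nonneg h0 h1 _)

theorem ww_sum (N : ℕ) : ∑ k ∈ Finset.Ico 1 N, ww α q N k ≤ 1 := by
  unfold ww
  rw [← Finset.sum_div]
  exact div_self_le_one _

theorem inv_ss_tendsto (ha : -1 / 2 ≤ α) (h0 : 0 ≤ q) (h1 : q ≤ 1) :
    Tendsto (fun N => 32 / ss α q N) atTop (nhds 0) :=
  tendsto_const_nhds.div_atTop (ss_tendsto ha h0 h1)

theorem ww_tendsto (ha : -1 / 2 ≤ α) (h0 : 0 ≤ q) (h1 : q ≤ 1) (hq : (α + 1) / 4 ≤ q)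
    (k : ℕ) : Tendsto (fun N => ww α q N k) atTop (nhds 0) := by
  have hlim : Tendsto (fun N => 32 / ss α q N +
      32 * (|gg α q N (k + 1)| / Real.sqrt (ss α q N)) ^ 2) atTop (nhds 0) := by
    simpa using (inv_ss_tendsto ha h0 h1).add
      (((gg_tendsto ha h0 h1 hq (by omega : 1 ≤ k + 1)).pow 2).const_mul 32)
  refine squeeze_zero (fun N => ww_nonneg h0 h1 N k) (fun N => ?_) hlim
  have hs := ss_nonneg (α := α) h0 h1 N
  rw [div_pow, sq_abs, Real.sq_sqrt hs]
  unfold ww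
  refine (div_le_div_of_nonneg_right (QQ_le ha (by linarith) h0 h1 _) hs).trans (le_of_eq ?_)
  ring

theorem ww_le (ha : -1 / 2 ≤ α) (h0 : 0 ≤ q) (h1 : q ≤ 1) (hq : (α + 1) / 4 ≤ q)
    (N k : ℕ) (hN : 0 < ss α q N) : ww α q N k ≤ 32 / ss α q N + 128 / ((k : ℝ) + 1) := by
  have h := QQ_le ha (by linarith) h0 h1 (gg α q N (k + 1))
  have h2 := gg_sq_le (N := N) ha h0 h1 (by omega : 1 ≤ k + 1)
  push_cast at h2
  unfold ww
  rw [div_le_iff₀ hN]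
  have e : (32 / ss α q N + 128 / ((k : ℝ) + 1)) * ss α q N =
      32 * (1 + ss α q N * (4 / ((k : ℝ) + 1))) := by field_simp; ring
  rw [e]
  linarith

theorem sum_ww_aux (ha : -1 / 2 ≤ α) (h0 : 0 ≤ q) (h1 : q ≤ 1) (hq : (α + 1) / 4 ≤ q)
    (f : ℝ → ℝ) (hf : Continuous f) (hf0 : f 0 = 0) (hfn : ∀ x, 0 ≤ f x)
    (hfa : ∀ x y z, 0 ≤ x → 0 ≤ y → 0 ≤ z → x ≤ y + z → f x ≤ f y + f z) :
    Tendsto (fun N => ∑ k ∈ Finset.Ico 1 N, ww α q N k * f (ww α q N k)) atTop (nhds 0) := by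
  have hg : Tendsto (fun k : ℕ => f (128 / ((k : ℝ) + 1))) atTop (nhds 0) := by
    have : Tendsto (fun k : ℕ => 128 / ((k : ℝ) + 1)) atTop (nhds 0) := by
      simpa [div_eq_mul_inv] using (tendsto_one_div_add_atTop_nhds_zero_nat (𝕜 := ℝ)).const_mul 128
    have h := (hf.tendsto 0).comp this
    rwa [hf0] at h
  have hr : Tendsto (fun N : ℕ => f (32 / ss α q N)) atTop (nhds 0) := by
    have h := (hf.tendsto 0).comp (inv_ss_tendsto ha h0 h1)
    rwa [hf0] at h
  have ht := toeplitz (ww α q) _ (ww_nonneg h0 h1) (Filter.Eventually.of_forall ww_sum)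
    (fun k _ => ww_tendsto ha h0 h1 hq k) (fun k => hfn _) hg
  have hlim := hr.add ht
  rw [add_zero] at hlim
  refine squeeze_zero' (Filter.Eventually.of_forall fun N => Finset.sum_nonneg fun k _ =>
    mul_nonneg (ww_nonneg h0 h1 N k) (hfn _)) ?_ hlim
  filter_upwards [(ss_tendsto ha h0 h1).eventually_gt_atTop 0] with N hN
  calc ∑ k ∈ Finset.Ico 1 N, ww α q N k * f (ww α q N k)
      ≤ ∑ k ∈ Finset.Ico 1 N, (f (32 / ss α q N) * ww α q N k +
          ww α q N k * f (128 / ((k : ℝ) + 1))) := by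
        refine Finset.sum_le_sum fun k _ => ?_
        have hw := ww_nonneg (α := α) h0 h1 N k
        have := hfa _ _ _ hw (by positivity) (by positivity) (ww_le ha h0 h1 hq N k hN)
        nlinarith
    _ ≤ _ := by
        rw [Finset.sum_add_distrib, ← Finset.mul_sum]
        have := mul_le_mul_of_nonneg_left (ww_sum (α := α) (q := q) N) (hfn (32 / ss α q N))
        linarith

theorem Ch_tendsto (ha : -1 / 2 ≤ α) (h0 : 0 < q) (h1 : q ≤ 1) (hq : (α + 1) / 4 ≤ q) (t : ℝ) :
    Tendsto (fun N => Ch P N (t / Real.sqrt (ss α q N)) N) atTop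
      (nhds ((Real.exp (-(t ^ 2) / 2) : ℝ) : ℂ)) := by
  have := P.isProb
  obtain ⟨κ, hk, hk1, hkq, hkq'⟩ : ∃ κ : ℝ, 0 < κ ∧ κ ≤ 1 ∧ κ ≤ q ∧ (1 - q = 0 ∨ κ ≤ 1 - q) := by
    rcases eq_or_lt_of_le h1 with h | h
    · exact ⟨1, one_pos, le_rfl, h.ge, Or.inl (by linarith)⟩
    · exact ⟨min q (1 - q), lt_min h0 (by linarith), (min_le_left _ _).trans h1, min_le_left _ _,
        Or.inr (min_le_right _ _)⟩
  have T1 := toeplitz (ww α q) _ (ww_nonneg h0.le h1) (Filter.Eventually.of_forall ww_sum)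
    (fun k _ => ww_tendsto ha h0.le h1 hq k)
    (fun k => div_nonneg (UU_nonneg P k) (sq_nonneg _)) (UU_tendsto P ha h0.le h1 hq)
  have T2 := sum_ww_aux ha h0.le h1 hq Real.sqrt Real.continuous_sqrt Real.sqrt_zero
    Real.sqrt_nonneg (fun x y z hx hy hz h => by
      refine (Real.sqrt_le_sqrt h).trans ?_
      rw [Real.sqrt_le_left (by positivity), add_sq, Real.sq_sqrt hy, Real.sq_sqrt hz]
      have : 0 ≤ 2 * Real.sqrt y * Real.sqrt z := by positivity
      linarith)
  have T3 := sum_ww_aux ha h0.le h1 hq (fun x => |x|) continuous_abs abs_zero abs_nonneg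
    (fun x y z hx hy hz h => by
      simp only [abs_of_nonneg hx, abs_of_nonneg hy, abs_of_nonneg hz]; exact h)
  have T := ((T1.const_mul (t ^ 2)).add ((T2.const_mul (64 / κ ^ 3 * |t| ^ 3)).add
    (T3.const_mul (t ^ 4))))
  simp only [mul_zero, add_zero] at T
  -- initial term
  have S : Tendsto (fun N => |t| * (Real.sqrt (ss α q N))⁻¹ +
      |t| * (|gg α q N 1| / Real.sqrt (ss α q N))) atTop (nhds 0) := by
    have hi : Tendsto (fun N => (Real.sqrt (ss α q N))⁻¹) atTop (nhds 0) :=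
      (Real.tendsto_sqrt_atTop.comp (ss_tendsto ha h0.le h1)).inv_tendsto_atTop
    simpa using (hi.const_mul |t|).add ((gg_tendsto ha h0.le h1 hq le_rfl).const_mul |t|)
  have TS := T.add S
  rw [add_zero] at TS
  rw [tendsto_iff_norm_sub_tendsto_zero]
  refine squeeze_zero' (Filter.Eventually.of_forall fun N => norm_nonneg _) ?_ TS
  filter_upwards [(ss_tendsto ha h0.le h1).eventually_gt_atTop 0, eventually_ge_atTop 1]
    with N hN hN1
  obtain ⟨τ, hτ⟩ : ∃ τ, τ = t / Real.sqrt (ss α q N) := ⟨_, rfl⟩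
  rw [← hτ]
  have hτ2 : τ ^ 2 = t ^ 2 / ss α q N := by rw [hτ, div_pow, Real.sq_sqrt hN.le]
  have hv : ∀ k, τ ^ 2 * QQ α q (gg α q N (k + 1)) = t ^ 2 * ww α q N k := by
    intro k; rw [hτ2]; unfold ww; ring
  have hsum : ∑ k ∈ Finset.Ico 1 N, τ ^ 2 * QQ α q (gg α q N (k + 1)) = t ^ 2 := by
    rw [← Finset.mul_sum, hτ2]
    exact div_mul_cancel₀ _ hN.ne'
  have hA := telescope (Ch P N τ) (fun k => τ ^ 2 * QQ α q (gg α q N (k + 1))) _ N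
    (fun k => mul_nonneg (sq_nonneg _) (QQ_nonneg h0.le h1 _))
    (fun k hk0 hkN => Ch_step P h0 h1 hk hk1 (Or.inr hkq) hkq' hk0 hkN τ) N hN1 le_rfl
  rw [hsum] at hA
  have hE : ∑ k ∈ Finset.Ico 1 N, (τ ^ 2 * QQ α q (gg α q N (k + 1)) * (UU P k / zz α k ^ 2) +
      (64 / κ ^ 3 * Real.sqrt (τ ^ 2 * QQ α q (gg α q N (k + 1))) ^ 3 +
      (τ ^ 2 * QQ α q (gg α q N (k + 1))) ^ 2)) =
      t ^ 2 * ∑ k ∈ Finset.Ico 1 N, ww α q N k * (UU P k / zz α k ^ 2) +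
      (64 / κ ^ 3 * |t| ^ 3 * ∑ k ∈ Finset.Ico 1 N, ww α q N k * Real.sqrt (ww α q N k) +
      t ^ 4 * ∑ k ∈ Finset.Ico 1 N, ww α q N k * |ww α q N k|) := by
    rw [Finset.mul_sum, Finset.mul_sum, Finset.mul_sum, ← Finset.sum_add_distrib,
      ← Finset.sum_add_distrib]
    refine Finset.sum_congr rfl fun k _ => ?_
    have hw := ww_nonneg (α := α) h0.le h1 N k
    rw [hv, Real.sqrt_mul (sq_nonneg _), Real.sqrt_sq_eq_abs, abs_of_nonneg hw]
    have e : Real.sqrt (ww α q N k) ^ 3 = ww α q N k * Real.sqrt (ww α q N k) := by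
      rw [pow_succ, Real.sq_sqrt hw]
    rw [mul_pow, e]
    ring
  rw [hE] at hA
  have hC1 : ‖Ch P N τ 1 - 1‖ ≤ |t| * (Real.sqrt (ss α q N))⁻¹ +
      |t| * (|gg α q N 1| / Real.sqrt (ss α q N)) := by
    have e : Ch P N τ 1 = Complex.exp (Complex.I * ((τ * (1 + gg α q N 1) : ℝ) : ℂ)) := by
      unfold Ch Phi
      simp [P.init]
      congr 1
      ring
    rw [e]
    refine Real.norm_exp_I_mul_ofReal_sub_one_le.trans ?_
    rw [hτ, Real.norm_eq_abs, abs_mul, abs_div, abs_of_nonneg (Real.sqrt_nonneg _)]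
    have h2 : |1 + gg α q N 1| ≤ 1 + |gg α q N 1| := by
      simpa using abs_add_le 1 (gg α q N 1)
    refine (mul_le_mul_of_nonneg_left h2 (by positivity)).trans (le_of_eq ?_)
    ring
  have hx : ‖((Real.exp (-(t ^ 2) / 2) : ℝ) : ℂ)‖ ≤ 1 := by
    rw [Complex.norm_real, Real.norm_of_nonneg (Real.exp_pos _).le]
    exact Real.exp_le_one_iff.2 (by nlinarith [sq_nonneg t])
  generalize ((Real.exp (-(t ^ 2) / 2) : ℝ) : ℂ) = X at *
  have e : Ch P N τ N - X = (Ch P N τ N - Ch P N τ 1 * X) + (Ch P N τ 1 - 1) * X := by ring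
  rw [e]
  refine (norm_add_le _ _).trans (add_le_add hA ?_)
  rw [norm_mul]
  calc _ ≤ ‖Ch P N τ 1 - 1‖ * 1 := mul_le_mul_of_nonneg_left hx (norm_nonneg _)
    _ ≤ _ := by rw [mul_one]; exact hC1

theorem gauss_half : ProbabilityTheory.gaussianReal 0 1 (Set.Iio 0) = 1 / 2 := by
  have hna : ProbabilityTheory.gaussianReal 0 1 {(0 : ℝ)} = 0 := by
    have := ProbabilityTheory.nullSingletonClass_gaussianReal (μ := 0) (v := 1) one_ne_zero
    exact measure_singleton 0
  have hsym : ProbabilityTheory.gaussianReal 0 1 (Set.Ioi 0) =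
      ProbabilityTheory.gaussianReal 0 1 (Set.Iio 0) := by
    have h := ProbabilityTheory.gaussianReal_map_neg (μ := 0) (v := 1)
    rw [neg_zero] at h
    conv_lhs => rw [← h]
    rw [Measure.map_apply measurable_neg measurableSet_Ioi]
    congr 1
    ext x; simp
  have htot : ProbabilityTheory.gaussianReal 0 1 (Set.Iio 0) +
      ProbabilityTheory.gaussianReal 0 1 (Set.Ioi 0) = 1 := by
    rw [← measure_union _ measurableSet_Ioi]
    · have e : Set.Iio (0 : ℝ) ∪ Set.Ioi 0 = {0}ᶜ := by
        ext x; simp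
      rw [e]
      exact (prob_compl_eq_one_iff (measurableSet_singleton _)).2 hna
    · exact Set.disjoint_left.2 fun x (hx : x < 0) (hx' : 0 < x) => lt_asymm hx hx'
  rw [hsym, ← two_mul] at htot
  rw [ENNReal.eq_div_iff two_ne_zero ENNReal.ofNat_ne_top]
  exact htot

theorem VSI_limit (ha : -1 / 2 ≤ α) (h0 : 0 < q) (h1 : q ≤ 1) (hq : (α + 1) / 4 ≤ q) :
    Tendsto (fun N : ℕ => (P.μ {ω | (P.Δ N ω).1 < 0}).toReal +
          (1 / 2) * (P.μ {ω | (P.Δ N ω).1 = 0}).toReal) atTop (nhds (1 / 2)) := by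
  have := P.isProb
  rw [← tendsto_add_atTop_iff_nat 1]
  let Y : ℕ → Ω → ℝ := fun n ω => ((P.Δ (n + 1) ω).1 : ℝ) / Real.sqrt (ss α q (n + 1))
  have hY : ∀ n, Measurable (Y n) := fun n =>
    (Measurable.of_discrete (f := fun x : ℤ × ℤ => (x.1 : ℝ) / Real.sqrt (ss α q (n + 1)))).comp
      (VSI_meas P (by omega : 1 ≤ n + 1))
  let ν : ℕ → ProbabilityMeasure ℝ := fun n =>
    ⟨P.μ.map (Y n), Measure.isProbabilityMeasure_map (hY n).aemeasurable⟩
  let G : ProbabilityMeasure ℝ := ⟨ProbabilityTheory.gaussianReal 0 1, inferInstance⟩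
  have hconv : Tendsto ν atTop (nhds G) := by
    refine ProbabilityMeasure.tendsto_iff_tendsto_charFun.2 fun t => ?_
    have e1 : charFun (G : Measure ℝ) t = ((Real.exp (-(t ^ 2) / 2) : ℝ) : ℂ) := by
      change charFun (ProbabilityTheory.gaussianReal 0 1) t = _
      rw [ProbabilityTheory.charFun_gaussianReal]
      push_cast
      congr 1
      simp
      ring
    rw [e1]
    refine ((tendsto_add_atTop_iff_nat 1).2 (Ch_tendsto P ha h0 h1 hq t)).congr fun n => ?_
    change _ = charFun (P.μ.map (Y n)) t
    rw [charFun_apply_real, integral_map (hY n).aemeasurable (by fun_prop)]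
    unfold Ch Phi
    rw [gg_self]
    congr 1
    funext ω
    congr 1
    simp only [Y]
    push_cast
    ring
  have hna : ProbabilityTheory.gaussianReal 0 1 {(0 : ℝ)} = 0 := by
    have := ProbabilityTheory.nullSingletonClass_gaussianReal (μ := 0) (v := 1) one_ne_zero
    exact measure_singleton 0
  have c1 := ProbabilityMeasure.tendsto_measure_of_null_frontier_of_tendsto' (E := Set.Iio 0) hconv
    (by rw [frontier_Iio]; exact hna)
  have c2 := ProbabilityMeasure.tendsto_measure_of_null_frontier_of_tendsto' (E := {0}) hconv
    (by rw [isClosed_singleton.frontier_eq, interior_singleton, Set.diff_empty]; exact hna)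
  have c1' := (ENNReal.tendsto_toReal (measure_ne_top (G : Measure ℝ) (Set.Iio 0))).comp c1
  have c2' := (ENNReal.tendsto_toReal (measure_ne_top (G : Measure ℝ) {0})).comp c2
  have hlim := c1'.add (c2'.const_mul (1 / 2))
  have e : ((G : Measure ℝ) (Set.Iio 0)).toReal + 1 / 2 * ((G : Measure ℝ) {0}).toReal = 1 / 2 := by
    change (ProbabilityTheory.gaussianReal 0 1 (Set.Iio 0)).toReal +
      1 / 2 * (ProbabilityTheory.gaussianReal 0 1 {0}).toReal = 1 / 2
    rw [gauss_half, hna]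
    simp
  rw [e] at hlim
  refine hlim.congr' ?_
  filter_upwards [(tendsto_add_atTop_iff_nat 1).2 (ss_tendsto ha h0.le h1) |>.eventually_gt_atTop 0]
    with n hn
  have hs := Real.sqrt_pos.2 hn
  have f1 : (ν n : Measure ℝ) (Set.Iio 0) = P.μ {ω | (P.Δ (n + 1) ω).1 < 0} := by
    change P.μ.map (Y n) (Set.Iio 0) = _
    rw [Measure.map_apply (hY n) measurableSet_Iio]
    congr 1
    ext ω
    simp [Y, div_neg_iff, hs, hs.not_gt]
  have f2 : (ν n : Measure ℝ) {0} = P.μ {ω | (P.Δ (n + 1) ω).1 = 0} := by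
    change P.μ.map (Y n) {0} = _
    rw [Measure.map_apply (hY n) (measurableSet_singleton _)]
    congr 1
    ext ω
    simp [Y, hs.ne']
  simp only [Function.comp]
  rw [f1, f2]

end final

/-- `R_maj(q) = 1/2` for `q ≥ (α+1)/4` on very simple increasing trees: the limsup of the
error probability `μ(Δ₁(N) < 0) + (1/2)μ(Δ₁(N) = 0)` of the majority estimator is `1/2`. -/
theorem vsi_majority_impossibility (α q : ℝ) (hα : α ∈ vsiAllowed)
    (hq0 : 0 ≤ q) (hq1 : q ≤ 1) (hq : (α + 1) / 4 ≤ q)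
    (Ω : Type) [MeasurableSpace Ω] (P : VSIProcess α q Ω) :
    Filter.limsup (fun N : ℕ =>
        (P.μ {ω | (P.Δ N ω).1 < 0}).toReal +
          (1 / 2) * (P.μ {ω | (P.Δ N ω).1 = 0}).toReal)
      Filter.atTop = 1 / 2 := by
  have ha : -1 / 2 ≤ α := by
    rcases hα with ⟨d, hd, rfl⟩ | h
    · have hd' : (2 : ℝ) ≤ d := by exact_mod_cast hd
      rw [div_le_div_iff₀ (by norm_num) (by linarith)]
      linarith
    · have h' : (0 : ℝ) ≤ α := h
      linarith
  exact (VSI_limit P ha (by linarith) hq1 hq).limsup_eq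
end

section
/- Let α ∈ {−1/d : d ∈ ℕ, d ≥ 2} ∪ [0,∞). For every γ ∈ (0, 1/2) there exist constants B > 1 and q₀ ∈ (0,1), depending only on α and γ, such that for every q ∈ (0, q₀) and every very simple increasing color-difference process (Δ(n))_{n≥1} with parameters (α, q): A := q^{γ − 1/2} satisfies A > B, and setting Y(n) := n/(Δ₁(n) + α·Δ₂(n))², for every n ≥ 1 the inequality E[ Y(n+1) | ℱ(n) ] ≤ Y(n) holds almost surely on the event {τ_high(A) ≤ n} ∩ {n < τ_low(B)}. -/
open MeasureTheory Filter
open scoped ENat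


lemma vsi_inv_sq (S d : ℝ) (hS : 0 < S) (hd : |d| ≤ S / 2) :
    1 / (S + d) ^ 2 ≤ (1 - 2 * (d / S) + 12 * (d / S) ^ 2) / S ^ 2 := by
  obtain ⟨t, rfl⟩ : ∃ t, d = S * t := ⟨d / S, by field_simp⟩
  have h1 := (abs_le.mp hd).1
  have ht : -(1 / 2) ≤ t := by
    by_contra h
    push Not at h
    nlinarith
  have e : S * t / S = t := by field_simp
  rw [e]
  have hpos : 0 < 1 + t := by linarith
  have e2 : 1 / (S + S * t) ^ 2 = (1 / (1 + t) ^ 2) / S ^ 2 := by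
    field_simp
  rw [e2]
  apply div_le_div_of_nonneg_right _ (by positivity)
  rw [div_le_iff₀ (by positivity)]
  have : 0 ≤ t ^ 2 * (9 + 22 * t + 12 * t ^ 2) := by
    apply mul_nonneg (by positivity)
    nlinarith
  nlinarith

lemma vsi_mean_bound (α q n Z : ℝ) (hα : -(1 / 2) ≤ α) (hn : 1600 ≤ n) (hq0 : 0 < q)
    (hq : q < 1 / 40) (hZ : Z = α * (1 - 1 / n) + 1) : 4 / 5 ≤ (1 + α - 2 * q) / Z := by
  have hn0 : 0 < n := by linarith
  have hi : 1 / n ≤ 1 / 1600 := one_div_le_one_div_of_le (by norm_num) hn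
  have hi0 : 0 < 1 / n := by positivity
  have hZ0 : 0 < Z := by rw [hZ]; nlinarith
  rw [le_div_iff₀ hZ0, hZ]
  nlinarith

lemma vsi_real (α q n Z S p : ℝ) (hα : -(1 / 2) ≤ α) (hq0 : 0 < q) (hq : q < 1 / 40)
    (hn : 1 ≤ n) (hZ : Z = α * (1 - 1 / n) + 1)
    (hS : 40 * (1 + |α|) * Z * Real.sqrt n < S)
    (hp : p = (1 / 2) * (1 + S / (Z * n))) (hp1 : p ≤ 1) :
    (n + 1) / (S + (1 + α)) ^ 2 * (p * (1 - q)) + (n + 1) / (S + (-1 + α)) ^ 2 * (p * q)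
      + (n + 1) / (S + (1 - α)) ^ 2 * ((1 - p) * q)
      + (n + 1) / (S + (-1 - α)) ^ 2 * ((1 - p) * (1 - q)) ≤ n / S ^ 2 := by
  have hn0 : 0 < n := by linarith
  have hi : 1 / n ≤ 1 := by rw [div_le_one hn0]; exact hn
  have hi0 : 0 < 1 / n := by positivity
  have hZ2 : 1 / 2 ≤ Z := by rw [hZ]; nlinarith
  have hZ0 : 0 < Z := by linarith
  set M := 1 + |α| with hM
  have hM1 : 1 ≤ M := by have := abs_nonneg α; linarith
  have hr1 : 1 ≤ Real.sqrt n := by rw [Real.one_le_sqrt]; exact hn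
  have hr2 : Real.sqrt n ^ 2 = n := Real.sq_sqrt hn0.le
  set r := Real.sqrt n with hr
  have hS20 : 20 * M * r ≤ S := by
    have : 0 ≤ (Z - 1 / 2) * (40 * M * r) := by
      apply mul_nonneg (by linarith); positivity
    nlinarith
  have hS0 : 0 < S := lt_of_lt_of_le (by positivity) hS20
  have hSM : 20 * M ≤ S := by nlinarith
  have hSsq : 400 * M ^ 2 * n ≤ S ^ 2 := by
    have := pow_le_pow_left₀ (by positivity) hS20 2
    calc 400 * M ^ 2 * n = (20 * M * r) ^ 2 := by rw [← hr2]; ring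
      _ ≤ _ := this
  have hSZ : S ≤ Z * n := by
    have : S / (Z * n) ≤ 1 := by linarith
    rwa [div_le_one (by positivity)] at this
  have hr40 : 40 ≤ r := by
    have h1 : Z * (40 * M * r) < Z * (r * r) := by
      have : r * r = n := by rw [← hr2]; ring
      rw [this]; linarith
    have h2 : 40 * M * r < r * r := lt_of_mul_lt_mul_left h1 hZ0.le
    have h3 : 40 * M < r := lt_of_mul_lt_mul_right h2 (by linarith)
    linarith
  have hn1600 : 1600 ≤ n := by nlinarith
  have hmean := vsi_mean_bound α q n Z hα hn1600 hq0 hq hZ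
  have hp0 : 0 ≤ p := by rw [hp]; positivity
  have hbound : ∀ d : ℝ, |d| ≤ M →
      (n + 1) / (S + d) ^ 2 ≤ ((n + 1) / S ^ 2) * (1 - 2 * (d / S) + 3 / (100 * n)) := by
    intro d hd
    have h1 := vsi_inv_sq S d hS0 (by linarith)
    have h2 : (d / S) ^ 2 ≤ 1 / (400 * n) := by
      rw [div_pow, div_le_div_iff₀ (by positivity) (by positivity)]
      have h3 : d ^ 2 ≤ M ^ 2 := by
        rw [← sq_abs d]; exact pow_le_pow_left₀ (abs_nonneg _) hd 2
      nlinarith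
    have h3 : 12 * (1 / (400 * n)) = 3 / (100 * n) := by field_simp; norm_num
    calc (n + 1) / (S + d) ^ 2 = (n + 1) * (1 / (S + d) ^ 2) := by ring
      _ ≤ (n + 1) * ((1 - 2 * (d / S) + 12 * (d / S) ^ 2) / S ^ 2) := by gcongr
      _ ≤ (n + 1) * ((1 - 2 * (d / S) + 3 / (100 * n)) / S ^ 2) := by
          gcongr
          linarith
      _ = _ := by ring
  have ha := abs_le.mp (le_refl |α|)
  have b1 := hbound (1 + α) (by rw [abs_le]; constructor <;> linarith)
  have b2 := hbound (-1 + α) (by rw [abs_le]; constructor <;> linarith)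
  have b3 := hbound (1 - α) (by rw [abs_le]; constructor <;> linarith)
  have b4 := hbound (-1 - α) (by rw [abs_le]; constructor <;> linarith)
  have hq1 : 0 ≤ 1 - q := by linarith
  have hp1' : 0 ≤ 1 - p := by linarith
  have c1 := mul_le_mul_of_nonneg_right b1 (mul_nonneg hp0 hq1)
  have c2 := mul_le_mul_of_nonneg_right b2 (mul_nonneg hp0 hq0.le)
  have c3 := mul_le_mul_of_nonneg_right b3 (mul_nonneg hp1' hq0.le)
  have c4 := mul_le_mul_of_nonneg_right b4 (mul_nonneg hp1' hq1)
  have hsum : ((n + 1) / S ^ 2) * (1 - 2 * ((1 + α) / S) + 3 / (100 * n)) * (p * (1 - q))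
      + ((n + 1) / S ^ 2) * (1 - 2 * ((-1 + α) / S) + 3 / (100 * n)) * (p * q)
      + ((n + 1) / S ^ 2) * (1 - 2 * ((1 - α) / S) + 3 / (100 * n)) * ((1 - p) * q)
      + ((n + 1) / S ^ 2) * (1 - 2 * ((-1 - α) / S) + 3 / (100 * n)) * ((1 - p) * (1 - q))
      = ((n + 1) / S ^ 2) * (1 - 2 * ((2 * p - 1) / S * (1 + α - 2 * q)) + 3 / (100 * n)) := by
    ring
  have hm : (2 * p - 1) / S * (1 + α - 2 * q) = (1 + α - 2 * q) / Z / n := by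
    rw [hp]; field_simp; ring
  have hfin : ((n + 1) / S ^ 2) * (1 - 2 * ((1 + α - 2 * q) / Z / n) + 3 / (100 * n))
      ≤ n / S ^ 2 := by
    have h1 : (4 / 5) / n ≤ (1 + α - 2 * q) / Z / n :=
      div_le_div_of_nonneg_right hmean hn0.le
    have h2 : (n + 1) * (1 - 2 * ((4 / 5) / n) + 3 / (100 * n)) ≤ n := by
      have : (n + 1) * (1 - 2 * ((4 / 5) / n) + 3 / (100 * n))
        = n + (1 - 157 / 100) - 157 / 100 * (1 / n) := by field_simp; ring
      rw [this]; linarith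
    calc _ ≤ ((n + 1) / S ^ 2) * (1 - 2 * ((4 / 5) / n) + 3 / (100 * n)) := by gcongr
      _ = ((n + 1) * (1 - 2 * ((4 / 5) / n) + 3 / (100 * n))) / S ^ 2 := by ring
      _ ≤ _ := div_le_div_of_nonneg_right h2 (by positivity)
  rw [hm] at hsum
  linarith

lemma vsi_above {α q : ℝ} {Ω : Type} [MeasurableSpace Ω] (P : VSIProcess α q Ω) (A B : ℝ)
    (hAB : B < A) (n : ℕ) (hZ : 0 ≤ Zvs α n) (ω : Ω) (h1 : tauHigh P A ω ≤ (n : ℕ∞))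
    (h2 : (n : ℕ∞) < tauLow P A B ω) :
    B * Zvs α n * Real.sqrt n < ((P.Δ n ω).1 : ℝ) + α * ((P.Δ n ω).2 : ℝ) := by
  by_contra h
  push Not at h
  rcases h1.lt_or_eq with hlt | heq
  · exact absurd h2 (not_lt.mpr (sInf_le ⟨n, rfl, hlt, h⟩))
  · have hne : {N : ℕ∞ | ∃ n : ℕ, N = (n : ℕ∞) ∧ 1 ≤ n ∧
        A * Zvs α n * Real.sqrt n < ((P.Δ n ω).1 : ℝ) + α * ((P.Δ n ω).2 : ℝ)}.Nonempty := by
      by_contra hE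
      rw [Set.not_nonempty_iff_eq_empty] at hE
      unfold tauHigh at heq
      rw [hE, sInf_empty] at heq
      exact absurd heq (ENat.top_ne_coe n)
    obtain ⟨m, hm, _, hlt⟩ := csInf_mem hne
    have hmn : m = n := by
      have : (m : ℕ∞) = n := by rw [← hm]; exact heq
      exact_mod_cast this
    subst hmn
    have : B * Zvs α m * Real.sqrt m ≤ A * Zvs α m * Real.sqrt m := by gcongr
    linarith

lemma vsi_range {α q : ℝ} {Ω : Type} [MeasurableSpace Ω] (P : VSIProcess α q Ω) (n : ℕ)
    (hn : 1 ≤ n) (ω : Ω) :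
    P.Δ n ω ∈ Set.Icc (-(n : ℤ)) n ×ˢ Set.Icc (-(n : ℤ)) n := by
  induction n, hn using Nat.le_induction with
  | base => rw [P.init]; simp
  | succ n hn ih =>
    have h := P.D_range n hn ω
    simp only [Set.mem_insert_iff, Set.mem_singleton_iff, Prod.ext_iff, Prod.fst_sub,
      Prod.snd_sub] at h
    simp only [Set.mem_prod, Set.mem_Icc] at ih ⊢
    push_cast
    omega

lemma vsi_condExp_term {α q : ℝ} {Ω : Type} [MeasurableSpace Ω] (P : VSIProcess α q Ω) (n : ℕ)
    (hn : 1 ≤ n) (g : ℤ × ℤ → ℝ) (v : ℤ × ℤ) :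
    Integrable (fun ω => g (P.Δ n ω) *
      Set.indicator {ω | P.Δ (n + 1) ω - P.Δ n ω = v} (fun _ => (1 : ℝ)) ω) P.μ ∧
    P.μ[fun ω => g (P.Δ n ω) *
      Set.indicator {ω | P.Δ (n + 1) ω - P.Δ n ω = v} (fun _ => (1 : ℝ)) ω | P.F n]
    =ᵐ[P.μ] fun ω => g (P.Δ n ω) *
      (P.μ[Set.indicator {ω | P.Δ (n + 1) ω - P.Δ n ω = v} (fun _ => (1 : ℝ)) | P.F n]) ω := by
  haveI := P.isProb
  have hfin : (Set.Icc (-(n : ℤ)) n ×ˢ Set.Icc (-(n : ℤ)) n).Finite :=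
    (Set.finite_Icc _ _).prod (Set.finite_Icc _ _)
  obtain ⟨C, hC⟩ := (hfin.image (fun x => ‖g x‖)).bddAbove
  have hb : ∀ ω, ‖g (P.Δ n ω)‖ ≤ C := fun ω => hC ⟨_, vsi_range P n hn ω, rfl⟩
  have hgm : StronglyMeasurable[P.F n] (fun ω => g (P.Δ n ω)) :=
    ((measurable_of_countable g).comp (P.adapted n hn)).stronglyMeasurable
  have hset : MeasurableSet {ω | P.Δ (n + 1) ω - P.Δ n ω = v} :=
    P.F_le (n + 1) _ (P.D_meas n hn (measurableSet_singleton v))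
  have hint : Integrable (Set.indicator {ω | P.Δ (n + 1) ω - P.Δ n ω = v}
      (fun _ => (1 : ℝ))) P.μ := (integrable_const _).indicator hset
  have hI : Integrable (fun ω => g (P.Δ n ω) *
      Set.indicator {ω | P.Δ (n + 1) ω - P.Δ n ω = v} (fun _ => (1 : ℝ)) ω) P.μ :=
    hint.bdd_mul (hgm.mono (P.F_le n)).aestronglyMeasurable (Eventually.of_forall hb)
  exact ⟨hI, condExp_mul_of_stronglyMeasurable_left hgm hI hint⟩

lemma vsi_condExp {α q : ℝ} {Ω : Type} [MeasurableSpace Ω] (P : VSIProcess α q Ω) (n : ℕ)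
    (hn : 1 ≤ n) (f : ℤ × ℤ → ℝ) :
    P.μ[fun ω => f (P.Δ (n + 1) ω) | P.F n] =ᵐ[P.μ] fun ω =>
      f (P.Δ n ω + (1, 1)) * (pvs α n (P.Δ n ω).1 (P.Δ n ω).2 * (1 - q))
      + f (P.Δ n ω + (-1, 1)) * (pvs α n (P.Δ n ω).1 (P.Δ n ω).2 * q)
      + f (P.Δ n ω + (1, -1)) * ((1 - pvs α n (P.Δ n ω).1 (P.Δ n ω).2) * q)
      + f (P.Δ n ω + (-1, -1)) * ((1 - pvs α n (P.Δ n ω).1 (P.Δ n ω).2) * (1 - q)) := by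
  let T : ℤ × ℤ → Ω → ℝ := fun v ω => f (P.Δ n ω + v) *
      Set.indicator {ω | P.Δ (n + 1) ω - P.Δ n ω = v} (fun _ => (1 : ℝ)) ω
  have hdec : (fun ω => f (P.Δ (n + 1) ω)) = T (1, 1) + T (-1, 1) + T (1, -1) + T (-1, -1) := by
    funext ω
    have h := P.D_range n hn ω
    have hs : P.Δ (n + 1) ω = P.Δ n ω + (P.Δ (n + 1) ω - P.Δ n ω) := by abel
    simp only [Set.mem_insert_iff, Set.mem_singleton_iff] at h
    rcases h with h | h | h | h <;> rw [h] at hs <;>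
      simp [T, Set.indicator, Set.mem_setOf_eq, h, ← hs]
  obtain ⟨i1, e1⟩ := vsi_condExp_term P n hn (fun x => f (x + (1, 1))) (1, 1)
  obtain ⟨i2, e2⟩ := vsi_condExp_term P n hn (fun x => f (x + (-1, 1))) (-1, 1)
  obtain ⟨i3, e3⟩ := vsi_condExp_term P n hn (fun x => f (x + (1, -1))) (1, -1)
  obtain ⟨i4, e4⟩ := vsi_condExp_term P n hn (fun x => f (x + (-1, -1))) (-1, -1)
  rw [hdec]
  have a1 : P.μ[T (1, 1) + T (-1, 1) + T (1, -1) + T (-1, -1) | P.F n] =ᵐ[P.μ] _ :=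
    condExp_add ((i1.add i2).add i3) i4 (P.F n)
  have a2 : P.μ[T (1, 1) + T (-1, 1) + T (1, -1) | P.F n] =ᵐ[P.μ] _ :=
    condExp_add (i1.add i2) i3 (P.F n)
  have a3 : P.μ[T (1, 1) + T (-1, 1) | P.F n] =ᵐ[P.μ] _ := condExp_add i1 i2 (P.F n)
  filter_upwards [a1, a2, a3, e1, e2, e3, e4, P.cond_rr n hn, P.cond_br n hn, P.cond_rb n hn,
    P.cond_bb n hn] with ω a1 a2 a3 e1 e2 e3 e4 c1 c2 c3 c4
  rw [c1] at e1
  rw [c2] at e2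
  rw [c3] at e3
  rw [c4] at e4
  rw [a1, Pi.add_apply]
  erw [a2]
  rw [Pi.add_apply]
  erw [a3]
  rw [Pi.add_apply, ← e1, ← e2, ← e3, ← e4]

/-- Supermartingale property of `Y(n) = n/(Δ₁(n) + αΔ₂(n))²` between the stopping times
`τ_high(A)` and `τ_low(B)` for very simple increasing trees: for every `γ ∈ (0, 1/2)` there
are `B > 1` and `q₀ ∈ (0,1)` such that for all `q ∈ (0, q₀)`, `A := q^(γ-1/2)` satisfies
`A > B` and `E[Y(n+1) | ℱ(n)] ≤ Y(n)` a.s. on `{τ_high(A) ≤ n} ∩ {n < τ_low(B)}`. -/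
theorem vsi_Y_supermartingale (α : ℝ) (hα : α ∈ vsiAllowed)
    (γ : ℝ) (hγ0 : 0 < γ) (hγ : γ < 1 / 2) :
    ∃ B q₀ : ℝ, 1 < B ∧ 0 < q₀ ∧ q₀ < 1 ∧
      ∀ q : ℝ, 0 < q → q < q₀ →
        ∀ (Ω : Type) [MeasurableSpace Ω] (P : VSIProcess α q Ω),
          B < q ^ (γ - 1 / 2) ∧
          ∀ n : ℕ, 1 ≤ n →
            ∀ᵐ ω ∂P.μ,
              (tauHigh P (q ^ (γ - 1 / 2)) ω ≤ (n : ℕ∞) ∧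
                  (n : ℕ∞) < tauLow P (q ^ (γ - 1 / 2)) B ω) →
                (P.μ[fun ω' => (((n : ℝ) + 1)) /
                    ((((P.Δ (n + 1) ω').1 : ℝ) + α * ((P.Δ (n + 1) ω').2 : ℝ)) ^ 2)
                  | P.F n]) ω
                  ≤ (n : ℝ) / ((((P.Δ n ω).1 : ℝ) + α * ((P.Δ n ω).2 : ℝ)) ^ 2) := by
  have hα' : -(1 / 2) ≤ α := by
    rcases hα with ⟨d, hd, rfl⟩ | h
    · have hd' : (2 : ℝ) ≤ d := by exact_mod_cast hd
      have := one_div_le_one_div_of_le (by norm_num) hd'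
      rw [neg_div]
      linarith
    · have : (0 : ℝ) ≤ α := h
      linarith
  set B : ℝ := 40 * (1 + |α|) with hB
  have hB1 : 1 < B := by have := abs_nonneg α; linarith
  have hB0 : 0 < B := by linarith
  have he : γ - 1 / 2 < 0 := by linarith
  refine ⟨B, min (1 / 40) (B ^ (1 / (γ - 1 / 2))), hB1, ?_, ?_, ?_⟩
  · exact lt_min (by norm_num) (Real.rpow_pos_of_pos hB0 _)
  · exact lt_of_le_of_lt (min_le_left _ _) (by norm_num)
  intro q hq0 hq Ω _ P
  have hq40 : q < 1 / 40 := lt_of_lt_of_le hq (min_le_left _ _)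
  have hAB : B < q ^ (γ - 1 / 2) := by
    have h1 : q < B ^ (1 / (γ - 1 / 2)) := lt_of_lt_of_le hq (min_le_right _ _)
    have h2 := Real.rpow_lt_rpow_of_neg hq0 h1 he
    rwa [← Real.rpow_mul hB0.le, one_div_mul_cancel he.ne, Real.rpow_one] at h2
  refine ⟨hAB, fun n hn => ?_⟩
  have hnR : (1 : ℝ) ≤ n := by exact_mod_cast hn
  have hZ0 : 0 ≤ Zvs α n := by
    have hi : 1 / (n : ℝ) ≤ 1 := by rw [div_le_one (by linarith)]; exact hnR
    have hi0 : 0 < 1 / (n : ℝ) := by positivity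
    unfold Zvs
    nlinarith
  have hce := vsi_condExp P n hn
    (fun x => ((n : ℝ) + 1) / (((x.1 : ℝ) + α * (x.2 : ℝ)) ^ 2))
  have hnn : 0 ≤ᵐ[P.μ] P.μ[Set.indicator {ω | P.Δ (n + 1) ω - P.Δ n ω = (-1, -1)}
      (fun _ => (1 : ℝ)) | P.F n] :=
    condExp_nonneg (Eventually.of_forall fun ω => Set.indicator_nonneg (by simp) ω)
  filter_upwards [hce, hnn, P.cond_bb n hn] with ω h1 h2 h3 ⟨t1, t2⟩
  have hS := vsi_above P _ B hAB n hZ0 ω t1 t2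
  rw [h3] at h2
  have hp1 : pvs α n (P.Δ n ω).1 (P.Δ n ω).2 ≤ 1 := by
    have h2' : 0 ≤ (1 - pvs α n (P.Δ n ω).1 (P.Δ n ω).2) * (1 - q) := h2
    have := nonneg_of_mul_nonneg_left h2' (by linarith)
    linarith
  have key := vsi_real α q n (Zvs α n) (((P.Δ n ω).1 : ℝ) + α * ((P.Δ n ω).2 : ℝ))
    (pvs α n (P.Δ n ω).1 (P.Δ n ω).2) hα' hq0 hq40 hnR rfl hS rfl hp1
  rw [h1]
  refine le_of_eq_of_le ?_ key
  simp only [Prod.fst_add, Prod.snd_add]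
  push_cast
  congr 4 <;> ring
end

section
/- Let α ∈ {−1/d : d ∈ ℕ, d ≥ 2} ∪ [0,∞). There exist constants B > 1 and c_{α,2} > 0, depending only on α, such that for every q ∈ (0,1] and every very simple increasing color-difference process (Δ(n))_{n≥1} with parameters (α, q), setting A := q^{−1/4}: liminf_{N→∞} μ( {τ_high(A) ≤ N} ∩ {τ_low(B) > N} ) ≥ 1 − c_{α,2}·√q. -/
open MeasureTheory Filter
open scoped ENat


lemma vsi_alpha_ge {α : ℝ} (hα : α ∈ vsiAllowed) : -(1/2) ≤ α := by
  rcases hα with ⟨d, hd, rfl⟩ | h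
  · have : (2:ℝ) ≤ d := by exact_mod_cast hd
    rw [neg_div, neg_le_neg_iff]
    exact one_div_le_one_div_of_le (by norm_num) this
  · have : (0:ℝ) ≤ α := h
    linarith

lemma Zvs_mul {α : ℝ} {n : ℕ} (hn : 1 ≤ n) : Zvs α n * n = (1 + α) * n - α := by
  have : (n:ℝ) ≠ 0 := by positivity
  unfold Zvs
  field_simp
  ring

lemma Zvs_ge {α : ℝ} (hα : -(1/2) ≤ α) {n : ℕ} (hn : 1 ≤ n) : 1/2 ≤ Zvs α n := by
  have h1 : (1:ℝ) ≤ n := by exact_mod_cast hn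
  have h2 : 1 / (n:ℝ) ≤ 1 := by rw [div_le_one (by linarith)]; exact h1
  have h3 : 0 < 1 / (n:ℝ) := by positivity
  unfold Zvs
  nlinarith

lemma Zvs_le {α : ℝ} {n : ℕ} (hn : 1 ≤ n) : Zvs α n ≤ 1 + |α| := by
  have h1 : (1:ℝ) ≤ n := by exact_mod_cast hn
  have h2 : 1 / (n:ℝ) ≤ 1 := by rw [div_le_one (by linarith)]; exact h1
  have h3 : 0 < 1 / (n:ℝ) := by positivity
  unfold Zvs
  nlinarith [le_abs_self α, abs_nonneg α]

lemma vsi_pt1 {x d k : ℝ} (hk : 1 ≤ k) (hd : |d| ≤ k) (hx : 4 * k ≤ x) :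
    1 / (x + d)^2 ≤ 1 / x^2 - 2 * (1 / x^3 * d) + 8 * k^2 / x^4 := by
  obtain ⟨h1, h2⟩ := abs_le.1 hd
  have hx0 : 0 < x := by linarith
  have hxd : 0 < x + d := by linarith
  have hd2 : d^2 ≤ k^2 := by nlinarith
  have h3 : 1 / x^2 - 2 * (1 / x^3 * d) + 8 * d^2 / x^4 ≤
      1 / x^2 - 2 * (1 / x^3 * d) + 8 * k^2 / x^4 := by gcongr
  refine le_trans ?_ h3
  have h4 : 1 / x^2 - 2 * (1 / x^3 * d) + 8 * d^2 / x^4 = (x^2 - 2 * x * d + 8 * d^2) / x^4 := by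
    field_simp
  rw [h4, div_le_div_iff₀ (by positivity) (by positivity)]
  have h5 : (x^2 - 2 * x * d + 8 * d^2) * (x + d)^2 - 1 * x^4 =
      d^2 * ((x + 2 * d) * (5 * x + 4 * d)) := by ring
  have h6 : 0 ≤ d^2 * ((x + 2 * d) * (5 * x + 4 * d)) := by
    apply mul_nonneg (sq_nonneg d)
    apply mul_nonneg <;> linarith
  linarith

lemma vsi_pt2 {x s β q k : ℝ} (hx : 0 < x) (hs : 0 < s) (hβ : 1/2 ≤ β) (hq0 : 0 < q)
    (hq : q ≤ 1/16)
    (hxs : 32 * k^2 * s ≤ x^2) :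
    (s + β) * (1 / x^2 - 2 * (1 / x^3 * ((β - 2 * q) * x / s)) + 8 * k^2 / x^4) ≤ s / x^2 := by
  have e : (s + β) * (1 / x^2 - 2 * (1 / x^3 * ((β - 2 * q) * x / s)) + 8 * k^2 / x^4) =
    ((s + β) * (1 - 2 * (β - 2 * q) / s + 8 * k^2 / x^2)) / x^2 := by
    field_simp
  rw [e]
  have h1 : 8 * k^2 / x^2 ≤ (1/4) / s := by
    rw [div_le_div_iff₀ (by positivity) hs]; linarith
  have h2 : 1 - 2 * (β - 2 * q) / s + 8 * k^2 / x^2 ≤ 1 - β / s := by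
    have : 0 ≤ (β - 4 * q - 1/4) / s := div_nonneg (by linarith) hs.le
    have e2 : (β - 4 * q - 1/4) / s = 2 * (β - 2 * q) / s - β / s - (1/4) / s := by ring
    linarith
  gcongr
  calc _ ≤ (s + β) * (1 - β / s) := by gcongr
    _ = s - β^2 / s := by field_simp; ring
    _ ≤ s := by have : 0 ≤ β^2 / s := by positivity
                linarith

namespace VSIProcess

variable {α q : ℝ} {Ω : Type} [mΩ : MeasurableSpace Ω] (P : VSIProcess α q Ω)

/-- The combination `Δ₁ + α Δ₂`. -/
noncomputable def X (n : ℕ) (ω : Ω) : ℝ := ((P.Δ n ω).1 : ℝ) + α * ((P.Δ n ω).2 : ℝ)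

lemma X_meas {n : ℕ} (hn : 1 ≤ n) : Measurable[P.F n] (P.X n) := by
  have : Measurable (fun z : ℤ × ℤ => (z.1 : ℝ) + α * (z.2 : ℝ)) := measurable_of_countable _
  exact this.comp (P.adapted n hn)

lemma X_meas' {n : ℕ} (hn : 1 ≤ n) : Measurable (P.X n) :=
  (P.X_meas hn).mono (P.F_le n) le_rfl

lemma X_diff_abs {n : ℕ} (hn : 1 ≤ n) (ω : Ω) : |P.X (n+1) ω - P.X n ω| ≤ 1 + |α| := by
  have h := P.D_range n hn ω
  have e : P.X (n+1) ω - P.X n ω =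
      ((P.Δ (n+1) ω - P.Δ n ω).1 : ℝ) + α * ((P.Δ (n+1) ω - P.Δ n ω).2 : ℝ) := by
    simp only [X, Prod.fst_sub, Prod.snd_sub]; push_cast; ring
  rw [e]
  simp only [Set.mem_insert_iff, Set.mem_singleton_iff] at h
  rcases h with h | h | h | h <;> rw [h] <;>
  · rw [abs_le]
    push_cast
    constructor <;> linarith [le_abs_self α, neg_abs_le α]

lemma measSet_D {n : ℕ} (hn : 1 ≤ n) (z : ℤ × ℤ) :
    MeasurableSet {ω | P.Δ (n + 1) ω - P.Δ n ω = z} := by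
  have h := (P.D_meas n hn).mono (P.F_le (n+1)) le_rfl
  exact h (measurableSet_singleton z)

lemma integrable_ind {n : ℕ} (hn : 1 ≤ n) (z : ℤ × ℤ) :
    Integrable (Set.indicator {ω | P.Δ (n + 1) ω - P.Δ n ω = z} (fun _ => (1 : ℝ))) P.μ := by
  have := P.isProb
  exact (integrable_const 1).indicator (P.measSet_D hn z)

lemma integrable_diff {n : ℕ} (hn : 1 ≤ n) :
    Integrable (fun ω => P.X (n+1) ω - P.X n ω) P.μ := by
  have := P.isProb
  refine Integrable.of_bound (C := 1 + |α|) ?_ ?_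
  · exact ((P.X_meas' (by omega)).sub (P.X_meas' hn)).aestronglyMeasurable
  · exact Eventually.of_forall fun ω => P.X_diff_abs hn ω

lemma condExp_diff {n : ℕ} (hn : 1 ≤ n) :
    P.μ[fun ω => P.X (n+1) ω - P.X n ω | P.F n]
      =ᵐ[P.μ] fun ω => (1 + α - 2 * q) * P.X n ω / (Zvs α n * n) := by
  have := P.isProb
  have i1 := P.integrable_ind hn (1,1)
  have i2 := P.integrable_ind hn (-1,1)
  have i3 := P.integrable_ind hn (1,-1)
  have i4 := P.integrable_ind hn (-1,-1)
  set f1 := Set.indicator {ω | P.Δ (n + 1) ω - P.Δ n ω = (1,1)} (fun _ => (1 : ℝ)) with hf1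
  set f2 := Set.indicator {ω | P.Δ (n + 1) ω - P.Δ n ω = (-1,1)} (fun _ => (1 : ℝ)) with hf2
  set f3 := Set.indicator {ω | P.Δ (n + 1) ω - P.Δ n ω = (1,-1)} (fun _ => (1 : ℝ)) with hf3
  set f4 := Set.indicator {ω | P.Δ (n + 1) ω - P.Δ n ω = (-1,-1)} (fun _ => (1 : ℝ)) with hf4
  have e : (fun ω => P.X (n+1) ω - P.X n ω) =
      (((1 + α) • f1 + (-1 + α) • f2) + ((1 - α) • f3 + (-1 - α) • f4)) := by
    funext ω
    have h := P.D_range n hn ω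
    have e : P.X (n+1) ω - P.X n ω =
      ((P.Δ (n+1) ω - P.Δ n ω).1 : ℝ) + α * ((P.Δ (n+1) ω - P.Δ n ω).2 : ℝ) := by
      simp only [X, Prod.fst_sub, Prod.snd_sub]; push_cast; ring
    rw [e]
    simp only [Set.mem_insert_iff, Set.mem_singleton_iff] at h
    simp only [Pi.add_apply, Pi.smul_apply, hf1, hf2, hf3, hf4, Set.indicator_apply,
      Set.mem_setOf_eq, smul_eq_mul]
    rcases h with h | h | h | h <;> rw [h] <;> norm_num <;> ring
  rw [e]
  have c1 := condExp_add (m := P.F n) (i1.smul (1 + α) |>.add (i2.smul (-1 + α)))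
    (i3.smul (1 - α) |>.add (i4.smul (-1 - α)))
  have c2 := condExp_add (m := P.F n) (i1.smul (1 + α)) (i2.smul (-1 + α))
  have c3 := condExp_add (m := P.F n) (i3.smul (1 - α)) (i4.smul (-1 - α))
  have s1 := condExp_smul (μ := P.μ) (1 + α) f1 (P.F n)
  have s2 := condExp_smul (μ := P.μ) (-1 + α) f2 (P.F n)
  have s3 := condExp_smul (μ := P.μ) (1 - α) f3 (P.F n)
  have s4 := condExp_smul (μ := P.μ) (-1 - α) f4 (P.F n)
  filter_upwards [c1, c2, c3, s1, s2, s3, s4, P.cond_rr n hn, P.cond_br n hn, P.cond_rb n hn,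
    P.cond_bb n hn] with ω c1 c2 c3 s1 s2 s3 s4 h1 h2 h3 h4
  rw [c1, Pi.add_apply, c2, c3, Pi.add_apply, Pi.add_apply, s1, s2, s3, s4]
  simp only [Pi.smul_apply, smul_eq_mul]
  rw [h1, h2, h3, h4]
  simp only [pvs, X]
  ring

lemma integral_pull {n : ℕ} (hn : 1 ≤ n) {h f g : Ω → ℝ} (hh : StronglyMeasurable[P.F n] h)
    {M : ℝ} (hM : ∀ ω, ‖h ω‖ ≤ M) (hf : Integrable f P.μ) (hfg : P.μ[f | P.F n] =ᵐ[P.μ] g) :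
    ∫ ω, h ω * f ω ∂P.μ = ∫ ω, h ω * g ω ∂P.μ := by
  have := P.isProb
  have hi : Integrable (h * f) P.μ :=
    hf.bdd_mul (hh.mono (P.F_le n)).aestronglyMeasurable (Eventually.of_forall hM)
  have h1 := condExp_mul_of_stronglyMeasurable_left (m := P.F n) (μ := P.μ) hh hi hf
  have h2 := integral_condExp (μ := P.μ) (P.F_le n) (f := h * f)
  change ∫ ω, (h * f) ω ∂P.μ = _
  rw [← h2]
  apply integral_congr_ae
  filter_upwards [h1, hfg] with ω h1 h3
  rw [h1, Pi.mul_apply, h3]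

lemma x_lower (hα : -(1/2) ≤ α) {n : ℕ} (hn : 1 ≤ n) {x k : ℝ} (hk : 1 ≤ k)
    (hx : 8 * k * Zvs α n * Real.sqrt n < x) :
    4 * k ≤ x ∧ 32 * k^2 * (Zvs α n * n) ≤ x^2 := by
  have hZ := Zvs_ge hα hn
  have h1 : (1:ℝ) ≤ n := by exact_mod_cast hn
  have hs : 1 ≤ Real.sqrt n := Real.one_le_sqrt.2 h1
  have hss : Real.sqrt n ^ 2 = n := Real.sq_sqrt (by linarith)
  have a1 : 4 * k * 1 ≤ 8 * k * Zvs α n * Real.sqrt n := by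
    apply mul_le_mul _ hs (by norm_num) (by positivity)
    nlinarith
  refine ⟨by linarith, ?_⟩
  have a2 : (8 * k * Zvs α n * Real.sqrt n)^2 ≤ x^2 := by
    apply pow_le_pow_left₀ _ hx.le
    linarith
  have a3 : (8 * k * Zvs α n * Real.sqrt n)^2 = 64 * k^2 * (Zvs α n)^2 * n := by
    rw [mul_pow, hss]; ring
  have a4 : 0 ≤ k^2 * (Zvs α n * n) * (2 * Zvs α n - 1) := by
    apply mul_nonneg (by positivity) (by linarith)
  nlinarith

lemma phi_integrable {n : ℕ} (hn : 1 ≤ n) {G : Set Ω} (hG : MeasurableSet G)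
    (hGx : ∀ ω ∈ G, 1 ≤ P.X n ω) (j : ℕ) :
    Integrable (G.indicator fun ω => 1 / P.X n ω ^ j) P.μ := by
  have := P.isProb
  refine Integrable.of_bound (C := 1) ?_ ?_
  · exact ((((P.X_meas' hn).pow_const j).const_div 1).indicator hG).aestronglyMeasurable
  · refine Eventually.of_forall fun ω => ?_
    by_cases h : ω ∈ G
    · rw [Set.indicator_of_mem h]
      have h1 := hGx ω h
      have h2 : 1 ≤ P.X n ω ^ j := one_le_pow₀ h1
      rw [Real.norm_of_nonneg (by positivity), div_le_one (by positivity)]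
      exact h2
    · rw [Set.indicator_of_notMem h]; simp

lemma phi_step (hα : -(1/2) ≤ α) (hq0 : 0 < q) (hq : q ≤ 1/16) {n : ℕ} (hn : 1 ≤ n) {G : Set Ω}
    (hG : MeasurableSet[P.F n] G)
    (hGx : ∀ ω ∈ G, 8 * (1 + |α|) * Zvs α n * Real.sqrt n < P.X n ω) :
    (Zvs α (n+1 : ℕ) * (n+1 : ℕ)) * ∫ ω, G.indicator (fun ω => 1 / P.X (n+1) ω ^ 2) ω ∂P.μ ≤
      (Zvs α n * n) * ∫ ω, G.indicator (fun ω => 1 / P.X n ω ^ 2) ω ∂P.μ := by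
  have := P.isProb
  have hG' : MeasurableSet G := P.F_le n _ hG
  set k := 1 + |α| with hk
  have hk1 : 1 ≤ k := by have := abs_nonneg α; linarith
  set s := Zvs α n * n with hs
  have hs0 : 0 < s := by
    have := Zvs_ge hα hn
    have : (1:ℝ) ≤ n := by exact_mod_cast hn
    positivity
  have hs' : Zvs α (n+1 : ℕ) * (n+1 : ℕ) = s + (1 + α) := by
    rw [hs, Zvs_mul hn, Zvs_mul (by omega)]; push_cast; ring
  rw [hs']
  have hx4 : ∀ ω ∈ G, 4 * k ≤ P.X n ω := fun ω h => (x_lower hα hn hk1 (hGx ω h)).1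
  have hx1 : ∀ ω ∈ G, 1 ≤ P.X n ω := fun ω h => by have := hx4 ω h; linarith
  have hx1' : ∀ ω ∈ G, 1 ≤ P.X (n+1) ω := fun ω h => by
    have := hx4 ω h
    have h2 := (abs_le.1 (P.X_diff_abs hn ω)).1
    linarith
  have i2 := P.phi_integrable hn hG' hx1 2
  have i3 := P.phi_integrable hn hG' hx1 3
  have i4 := P.phi_integrable hn hG' hx1 4
  have i2' := P.phi_integrable (n := n+1) (by omega) hG' hx1' 2
  have hb3 : ∀ ω, ‖G.indicator (fun ω => 1 / P.X n ω ^ 3) ω‖ ≤ 1 := by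
    intro ω
    by_cases h : ω ∈ G
    · rw [Set.indicator_of_mem h]
      have h1 := hx1 ω h
      have h2 : 1 ≤ P.X n ω ^ 3 := one_le_pow₀ h1
      rw [Real.norm_of_nonneg (by positivity), div_le_one (by positivity)]
      exact h2
    · rw [Set.indicator_of_notMem h]; simp
  have hm3 : StronglyMeasurable[P.F n] (G.indicator (fun ω => 1 / P.X n ω ^ 3)) := by
    have h0 : Measurable[P.F n] (fun ω => 1 / P.X n ω ^ 3) := by
      have : Measurable (fun x : ℝ => 1 / x ^ 3) := by fun_prop
      exact this.comp (P.X_meas hn)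
    exact (h0.indicator hG).stronglyMeasurable
  have hp := P.integral_pull hn hm3 hb3 (P.integrable_diff hn) (P.condExp_diff hn)
  have i3d : Integrable (fun ω => G.indicator (fun ω => 1 / P.X n ω ^ 3) ω *
      (P.X (n+1) ω - P.X n ω)) P.μ :=
    (P.integrable_diff hn).bdd_mul i3.aestronglyMeasurable (Eventually.of_forall hb3)
  have e3 : (fun ω => G.indicator (fun ω => 1 / P.X n ω ^ 3) ω *
      ((1 + α - 2 * q) * P.X n ω / s)) =
      fun ω => ((1 + α - 2 * q) / s) * G.indicator (fun ω => 1 / P.X n ω ^ 2) ω := by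
    funext ω
    by_cases h : ω ∈ G
    · rw [Set.indicator_of_mem h, Set.indicator_of_mem h]
      have h1 := hx1 ω h
      have : P.X n ω ≠ 0 := by positivity
      field_simp
    · rw [Set.indicator_of_notMem h, Set.indicator_of_notMem h]; ring
  rw [e3, integral_const_mul] at hp
  have step1 : ∫ ω, G.indicator (fun ω => 1 / P.X (n+1) ω ^ 2) ω ∂P.μ ≤
      ∫ ω, (G.indicator (fun ω => 1 / P.X n ω ^ 2) ω -
        2 * (G.indicator (fun ω => 1 / P.X n ω ^ 3) ω * (P.X (n+1) ω - P.X n ω)) +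
        8 * k^2 * G.indicator (fun ω => 1 / P.X n ω ^ 4) ω) ∂P.μ := by
    apply integral_mono i2' ((i2.sub (i3d.const_mul 2)).add (i4.const_mul _))
    intro ω
    by_cases h : ω ∈ G
    · simp only [Pi.add_apply, Pi.sub_apply, Set.indicator_of_mem h]
      have := vsi_pt1 hk1 (P.X_diff_abs hn ω) (hx4 ω h)
      rw [show P.X n ω + (P.X (n+1) ω - P.X n ω) = P.X (n+1) ω by ring] at this
      rw [show 8 * k^2 * (1 / P.X n ω ^ 4) = 8 * k^2 / P.X n ω ^ 4 by ring]
      exact this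
    · simp only [Pi.add_apply, Pi.sub_apply, Set.indicator_of_notMem h]; norm_num
  have j1 : Integrable (fun ω => G.indicator (fun ω => 1 / P.X n ω ^ 2) ω -
        2 * (G.indicator (fun ω => 1 / P.X n ω ^ 3) ω * (P.X (n+1) ω - P.X n ω))) P.μ :=
    i2.sub (i3d.const_mul 2)
  rw [integral_add j1 (i4.const_mul _),
    integral_sub i2 (i3d.const_mul 2), integral_const_mul, integral_const_mul, hp] at step1
  have step2 : ∫ ω, (s + (1 + α)) * (G.indicator (fun ω => 1 / P.X n ω ^ 2) ω -
      2 * (((1 + α - 2 * q) / s) * G.indicator (fun ω => 1 / P.X n ω ^ 2) ω) +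
      8 * k^2 * G.indicator (fun ω => 1 / P.X n ω ^ 4) ω) ∂P.μ ≤
      ∫ ω, s * G.indicator (fun ω => 1 / P.X n ω ^ 2) ω ∂P.μ := by
    apply integral_mono
      (((i2.sub ((i2.const_mul _).const_mul 2)).add (i4.const_mul _)).const_mul _) (i2.const_mul _)
    intro ω
    by_cases h : ω ∈ G
    · simp only [Pi.add_apply, Pi.sub_apply, Set.indicator_of_mem h]
      have h1 := hx1 ω h
      have h0 : P.X n ω ≠ 0 := by positivity
      have := vsi_pt2 (x := P.X n ω) (β := 1 + α) (by linarith) hs0 (by linarith) hq0 hq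
        (x_lower hα hn hk1 (hGx ω h)).2
      have key : 1 / P.X n ω ^ 3 * ((1 + α - 2 * q) * P.X n ω / s) =
          (1 + α - 2 * q) / s * (1 / P.X n ω ^ 2) := by field_simp
      rw [key] at this
      refine le_of_eq_of_le ?_ (this.trans_eq ?_)
      · ring
      · ring
    · simp only [Pi.add_apply, Pi.sub_apply, Set.indicator_of_notMem h]; norm_num
  have j2 : Integrable (fun ω => G.indicator (fun ω => 1 / P.X n ω ^ 2) ω -
      2 * (((1 + α - 2 * q) / s) * G.indicator (fun ω => 1 / P.X n ω ^ 2) ω)) P.μ :=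
    i2.sub ((i2.const_mul _).const_mul 2)
  rw [integral_const_mul, integral_add j2 (i4.const_mul _),
    integral_sub i2 ((i2.const_mul _).const_mul 2), integral_const_mul, integral_const_mul,
    integral_const_mul, integral_const_mul] at step2
  refine le_trans ?_ step2
  apply mul_le_mul_of_nonneg_left step1
  linarith

/-- No mutation up to time `n`. -/
def E (n : ℕ) : Set Ω := {ω | ∀ k, 1 ≤ k → k ≤ n → P.Δ k ω = ((k : ℤ), (k : ℤ) - 1)}

lemma E_meas (n : ℕ) : MeasurableSet[P.F n] (P.E n) := by
  have : P.E n = ⋂ k : ℕ, ⋂ _ : 1 ≤ k, ⋂ _ : k ≤ n, {ω | P.Δ k ω = ((k : ℤ), (k : ℤ) - 1)} := by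
    ext ω; simp [E]
  rw [this]
  refine MeasurableSet.iInter fun k => MeasurableSet.iInter fun h1 => MeasurableSet.iInter fun h2 =>
    P.F_mono h2 _ ?_
  exact P.adapted k h1 (measurableSet_singleton _)

lemma X_E {n k : ℕ} {ω : Ω} (h : ω ∈ P.E n) (h1 : 1 ≤ k) (h2 : k ≤ n) :
    P.X k ω = Zvs α k * k := by
  rw [Zvs_mul h1, X, h k h1 h2]; push_cast; ring

lemma E_prob (hα : -(1/2) ≤ α) (hq0 : 0 < q) (hq : q ≤ 1) {n : ℕ} (hn : 1 ≤ n) :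
    1 - ((n:ℝ) - 1) * q ≤ P.μ.real (P.E n) := by
  have := P.isProb
  induction n, hn using Nat.le_induction with
  | base =>
    have : P.E 1 = Set.univ := by
      ext ω
      simp only [E, Set.mem_setOf_eq, Set.mem_univ, iff_true]
      intro k h1 h2
      obtain rfl : k = 1 := by omega
      simp [P.init]
    rw [this]; simp
  | succ n hn ih =>
    have hEm := P.E_meas n
    have hEm' : MeasurableSet (P.E n) := P.F_le n _ hEm
    have hsub : P.E n ∩ {ω | P.Δ (n + 1) ω - P.Δ n ω = (1,1)} ⊆ P.E (n+1) := by
      rintro ω ⟨h1, h2⟩ k hk1 hk2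
      rcases Nat.lt_or_ge n k with h | h
      · obtain rfl : k = n + 1 := by omega
        have h3 := h1 n hn le_rfl
        have h2' : P.Δ (n + 1) ω - P.Δ n ω = (1,1) := h2
        rw [h3] at h2'
        rw [sub_eq_iff_eq_add.1 h2']
        ext <;> simp <;> ring
      · exact h1 k hk1 h
    have hm := measureReal_mono (μ := P.μ) hsub
    have hp := P.integral_pull hn (h := (P.E n).indicator fun _ => (1:ℝ)) (M := 1)
      ((measurable_const.indicator hEm).stronglyMeasurable)
      (by intro ω; by_cases h : ω ∈ P.E n <;> simp [h]) (P.integrable_ind hn (1,1)) (P.cond_rr n hn)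
    have l1 : ∫ ω, (P.E n).indicator (fun _ => (1:ℝ)) ω *
        Set.indicator {ω | P.Δ (n + 1) ω - P.Δ n ω = (1,1)} (fun _ => (1 : ℝ)) ω ∂P.μ =
        P.μ.real (P.E n ∩ {ω | P.Δ (n + 1) ω - P.Δ n ω = (1,1)}) := by
      rw [← integral_indicator_one (hEm'.inter (P.measSet_D hn _))]
      congr 1
      funext ω
      by_cases h1 : ω ∈ P.E n
      · by_cases h2 : ω ∈ {ω | P.Δ (n + 1) ω - P.Δ n ω = (1,1)}
        · rw [Set.indicator_of_mem h1, Set.indicator_of_mem h2,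
            Set.indicator_of_mem (show ω ∈ P.E n ∩ {ω | P.Δ (n + 1) ω - P.Δ n ω = (1,1)} from ⟨h1, h2⟩)]
          simp
        · rw [Set.indicator_of_notMem h2,
            Set.indicator_of_notMem (show ω ∉ P.E n ∩ {ω | P.Δ (n + 1) ω - P.Δ n ω = (1,1)} from fun h => h2 h.2)]
          simp
      · rw [Set.indicator_of_notMem h1,
            Set.indicator_of_notMem (show ω ∉ P.E n ∩ {ω | P.Δ (n + 1) ω - P.Δ n ω = (1,1)} from fun h => h1 h.1)]
        simp
    have l2 : ∫ ω, (P.E n).indicator (fun _ => (1:ℝ)) ω *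
        (pvs α n (P.Δ n ω).1 (P.Δ n ω).2 * (1 - q)) ∂P.μ = (1 - q) * P.μ.real (P.E n) := by
      rw [← integral_indicator_one hEm', ← integral_const_mul]
      congr 1
      funext ω
      by_cases h : ω ∈ P.E n
      · rw [Set.indicator_of_mem h, Set.indicator_of_mem h]
        have h3 := P.X_E h hn le_rfl
        have h0 : Zvs α n * n ≠ 0 := by
          have := Zvs_ge hα hn
          have : (1:ℝ) ≤ n := by exact_mod_cast hn
          positivity
        have : pvs α n (P.Δ n ω).1 (P.Δ n ω).2 = 1 := by
          unfold pvs
          unfold X at h3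
          rw [h3, div_self h0]; norm_num
        rw [this]; simp
      · rw [Set.indicator_of_notMem h, Set.indicator_of_notMem h]; simp
    rw [l1, l2] at hp
    rw [hp] at hm
    refine le_trans ?_ hm
    have h1 : (1:ℝ) ≤ n := by exact_mod_cast hn
    have h2 : (1 - q) * (1 - ((n:ℝ) - 1) * q) ≤ (1 - q) * P.μ.real (P.E n) :=
      mul_le_mul_of_nonneg_left ih (by linarith)
    push_cast
    nlinarith [mul_nonneg (sub_nonneg.2 h1) (sq_nonneg q)]

/-- Good set: no mutation up to `m`, then above the barrier between `m` and `n`. -/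
def G (m n : ℕ) : Set Ω := P.E m ∩ {ω | ∀ k, m ≤ k → k ≤ n →
  8 * (1 + |α|) * Zvs α k * Real.sqrt k < P.X k ω}

lemma G_meas {m n : ℕ} (hm : 1 ≤ m) (hmn : m ≤ n) : MeasurableSet[P.F n] (P.G m n) := by
  refine MeasurableSet.inter (P.F_mono hmn _ (P.E_meas m)) ?_
  have : {ω | ∀ k, m ≤ k → k ≤ n → 8 * (1 + |α|) * Zvs α k * Real.sqrt k < P.X k ω} =
    ⋂ k : ℕ, ⋂ _ : m ≤ k, ⋂ _ : k ≤ n, {ω | 8 * (1 + |α|) * Zvs α k * Real.sqrt k < P.X k ω} := by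
    ext ω; simp
  rw [this]
  refine MeasurableSet.iInter fun k => MeasurableSet.iInter fun h1 => MeasurableSet.iInter fun h2 =>
    P.F_mono h2 _ ?_
  exact P.X_meas (hm.trans h1) measurableSet_Ioi

lemma G_bound (hα : -(1/2) ≤ α) (hq0 : 0 < q) (hq : q ≤ 1/16) {m n : ℕ} (hm : 1 ≤ m)
    (hmn : m ≤ n) (hB : 8 * (1 + |α|) < Real.sqrt m) :
    P.μ.real (P.E m \ P.G m n) + 64 * (1 + |α|)^3 * ((Zvs α n * n) *
      ∫ ω, (P.G m n).indicator (fun ω => 1 / P.X n ω ^ 2) ω ∂P.μ) ≤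
      128 * (1 + |α|)^3 / m := by
  have := P.isProb
  set k := 1 + |α| with hk
  have hk1 : 1 ≤ k := by have := abs_nonneg α; linarith
  have hEm (n) : MeasurableSet (P.E n) := P.F_le n _ (P.E_meas n)
  have hGm {n} (h : m ≤ n) : MeasurableSet (P.G m n) := P.F_le n _ (P.G_meas hm h)
  induction n, hmn using Nat.le_induction with
  | base =>
    have hZ := Zvs_ge hα hm
    have h1 : (1:ℝ) ≤ m := by exact_mod_cast hm
    have hss : Real.sqrt m * Real.sqrt m = m := Real.mul_self_sqrt (by linarith)
    have hGE : P.G m m = P.E m := by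
      apply Set.inter_eq_left.2
      intro ω hω j h1 h2
      obtain rfl : j = m := by omega
      rw [P.X_E hω hm le_rfl]
      calc 8 * k * Zvs α j * Real.sqrt j = Zvs α j * (8 * k * Real.sqrt j) := by ring
        _ < Zvs α j * (Real.sqrt j * Real.sqrt j) := by gcongr
        _ = _ := by rw [hss]
    rw [hGE, Set.diff_self, measureReal_empty, zero_add]
    have e : ∫ ω, (P.E m).indicator (fun ω => 1 / P.X m ω ^ 2) ω ∂P.μ =
        (1 / (Zvs α m * m) ^ 2) * P.μ.real (P.E m) := by
      rw [← integral_indicator_one (hEm m), ← integral_const_mul]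
      congr 1
      funext ω
      by_cases h : ω ∈ P.E m
      · rw [Set.indicator_of_mem h, Set.indicator_of_mem h, P.X_E h hm le_rfl]; simp
      · rw [Set.indicator_of_notMem h, Set.indicator_of_notMem h]; simp
    rw [e]
    have hle : P.μ.real (P.E m) ≤ 1 := measureReal_le_one
    have hs0 : 0 < Zvs α m * m := by positivity
    have e2 : 64 * k^3 * ((Zvs α m * m) * ((1 / (Zvs α m * m) ^ 2) * P.μ.real (P.E m))) =
      64 * k^3 / (Zvs α m * m) * P.μ.real (P.E m) := by field_simp
    rw [e2]
    calc 64 * k^3 / (Zvs α m * m) * P.μ.real (P.E m) ≤ 64 * k^3 / (Zvs α m * m) * 1 := by gcongr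
      _ = 64 * k^3 / (Zvs α m * m) := by ring
      _ ≤ 64 * k^3 / (1/2 * m) := by gcongr
      _ = 128 * k^3 / m := by field_simp; norm_num
  | succ n hmn ih =>
    have hn : 1 ≤ n := hm.trans hmn
    refine le_trans ?_ ih
    have hGx : ∀ ω ∈ P.G m n, 8 * (1 + |α|) * Zvs α n * Real.sqrt n < P.X n ω :=
      fun ω h => h.2 n hmn le_rfl
    have hst := P.phi_step hα hq0 hq hn (P.G_meas hm hmn) hGx
    set s' := Zvs α (n+1 : ℕ) * ((n+1 : ℕ) : ℝ) with hs'
    have hZ' := Zvs_ge hα (n := n+1) (by omega)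
    have hZle := Zvs_le (α := α) (n := n+1) (by omega)
    have hs0 : 0 < s' := by positivity
    have hGG : P.G m (n+1) ⊆ P.G m n := fun ω h => ⟨h.1, fun j h1 h2 => h.2 j h1 (by omega)⟩
    have hx1' : ∀ ω ∈ P.G m n, 1 ≤ P.X (n+1) ω := fun ω h => by
      have := (x_lower hα hn hk1 (hGx ω h)).1
      have h2 := (abs_le.1 (P.X_diff_abs hn ω)).1
      linarith
    have iG := P.phi_integrable (n := n+1) (by omega) (hGm hmn) hx1' 2
    have iG' := P.phi_integrable (n := n+1) (by omega) (hGm (n := n+1) (by omega))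
      (fun ω h => hx1' ω (hGG h)) 2
    have hdiff : P.μ.real (P.E m \ P.G m (n+1)) =
        P.μ.real (P.E m \ P.G m n) + P.μ.real (P.G m n \ P.G m (n+1)) := by
      rw [← measureReal_union _ ((hGm hmn).diff (hGm (by omega)))]
      · congr 1
        ext ω
        have h1 : ω ∈ P.G m n → ω ∈ P.E m := fun h => h.1
        have h2 := @hGG ω
        simp only [Set.mem_diff, Set.mem_union]
        tauto
      · rw [Set.disjoint_left]
        rintro ω h1 h2
        exact h1.2 h2.1
    have hmain : P.μ.real (P.G m n \ P.G m (n+1)) + 64 * k^3 * (s' *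
        ∫ ω, (P.G m (n+1)).indicator (fun ω => 1 / P.X (n+1) ω ^ 2) ω ∂P.μ) ≤
        64 * k^3 * (s' * ∫ ω, (P.G m n).indicator (fun ω => 1 / P.X (n+1) ω ^ 2) ω ∂P.μ) := by
      have hdm := (hGm hmn).diff (hGm (n := n+1) (by omega))
      have i1 : Integrable ((P.G m n \ P.G m (n+1)).indicator (1 : Ω → ℝ)) P.μ :=
        (integrable_const (1:ℝ)).indicator hdm
      rw [← integral_indicator_one hdm]
      simp only [← integral_const_mul]
      rw [← integral_add i1 ((iG'.const_mul _).const_mul _)]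
      apply integral_mono (i1.add ((iG'.const_mul _).const_mul _)) ((iG.const_mul _).const_mul _)
      intro ω
      by_cases h1 : ω ∈ P.G m (n+1)
      · have h2 := hGG h1
        simp [h1, h2]
      · by_cases h2 : ω ∈ P.G m n
        · have hbad : P.X (n+1) ω ≤ 8 * k * Zvs α (n+1 : ℕ) * Real.sqrt (n+1 : ℕ) := by
            by_contra hcon
            apply h1
            refine ⟨h2.1, fun j hj1 hj2 => ?_⟩
            rcases Nat.lt_or_ge n j with h | h
            · obtain rfl : j = n + 1 := by omega
              exact not_le.1 hcon
            · exact h2.2 j hj1 h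
          have hx := hx1' ω h2
          have hss : Real.sqrt ((n+1 : ℕ):ℝ) ^ 2 = ((n+1 : ℕ):ℝ) := Real.sq_sqrt (by positivity)
          have hsq : P.X (n+1) ω ^ 2 ≤ 64 * k^3 * s' := by
            calc P.X (n+1) ω ^ 2 ≤ (8 * k * Zvs α (n+1 : ℕ) * Real.sqrt (n+1 : ℕ))^2 := by gcongr
              _ = 64 * k^2 * Zvs α (n+1 : ℕ) * s' := by rw [mul_pow, hss, hs']; ring
              _ ≤ 64 * k^2 * k * s' := by gcongr
              _ = _ := by ring
          have h3 : ω ∈ P.G m n \ P.G m (n+1) := ⟨h2, h1⟩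
          simp only [Pi.add_apply, Set.indicator_of_mem h3, Set.indicator_of_mem h2, Set.indicator_of_notMem h1,
            Pi.one_apply, mul_zero, add_zero]
          rw [show 64 * k^3 * (s' * (1 / P.X (n+1) ω ^ 2)) = 64 * k^3 * s' / P.X (n+1) ω ^ 2 by ring,
            one_le_div (by positivity)]
          exact hsq
        · have h3 : ω ∉ P.G m n \ P.G m (n+1) := fun h => h2 h.1
          simp [h1, h2]
    have : 64 * k^3 * (s' * ∫ ω, (P.G m n).indicator (fun ω => 1 / P.X (n+1) ω ^ 2) ω ∂P.μ) ≤
      64 * k^3 * ((Zvs α n * n) * ∫ ω, (P.G m n).indicator (fun ω => 1 / P.X n ω ^ 2) ω ∂P.μ) :=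
      mul_le_mul_of_nonneg_left hst (by positivity)
    linarith

lemma G_sub (hα : -(1/2) ≤ α) {A : ℝ} (hA : 0 < A) {m N : ℕ} (hm : 1 ≤ m) (hmN : m ≤ N)
    (h1 : A ^ 2 < m) (h2 : (m:ℝ) - 1 ≤ A ^ 2) :
    P.G m N ⊆ {ω | tauHigh P A ω ≤ (N : ℕ∞) ∧
                (N : ℕ∞) < tauLow P A (8 * (1 + |α|)) ω} := by
  rintro ω ⟨hE, hG⟩
  have hhigh : tauHigh P A ω ≤ (m : ℕ∞) := by
    apply sInf_le
    refine ⟨m, rfl, hm, ?_⟩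
    change _ < P.X m ω
    rw [P.X_E hE hm le_rfl]
    have hZ := Zvs_ge hα hm
    have h3 : A < Real.sqrt m := Real.lt_sqrt_of_sq_lt h1
    have hss : Real.sqrt m * Real.sqrt m = m := Real.mul_self_sqrt (by positivity)
    calc A * Zvs α m * Real.sqrt m = Zvs α m * (A * Real.sqrt m) := by ring
        _ < Zvs α m * (Real.sqrt m * Real.sqrt m) := by gcongr
        _ = _ := by rw [hss]
  have hlow : (m : ℕ∞) ≤ tauHigh P A ω := by
    apply le_sInf
    rintro _ ⟨n, rfl, hn, hlt⟩
    by_contra hcon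
    have hnm : n < m := by exact_mod_cast not_le.1 hcon
    change _ < P.X n ω at hlt
    rw [P.X_E hE hn hnm.le] at hlt
    have hZ := Zvs_ge hα hn
    have h3 : (n:ℝ) ≤ m - 1 := by
      have : (n:ℝ) + 1 ≤ m := by exact_mod_cast hnm
      linarith
    have h4 : Real.sqrt n ≤ A := Real.sqrt_le_iff.2 ⟨hA.le, by linarith⟩
    have hss : Real.sqrt n * Real.sqrt n = n := Real.mul_self_sqrt (by positivity)
    have : Zvs α n * n ≤ A * Zvs α n * Real.sqrt n := by
      calc Zvs α n * n = Zvs α n * (Real.sqrt n * Real.sqrt n) := by rw [hss]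
        _ ≤ Zvs α n * (A * Real.sqrt n) := by gcongr
        _ = _ := by ring
    linarith
  refine ⟨hhigh.trans (by exact_mod_cast hmN), ?_⟩
  have : ((N + 1 : ℕ) : ℕ∞) ≤ tauLow P A (8 * (1 + |α|)) ω := by
    apply le_sInf
    rintro _ ⟨n, rfl, hn, hle⟩
    by_contra hcon
    have hnN : n < N + 1 := by exact_mod_cast not_le.1 hcon
    have hmn : m < n := by exact_mod_cast hlow.trans_lt hn
    have := hG n hmn.le (by omega)
    exact absurd hle (not_le.2 this)
  refine lt_of_lt_of_le ?_ this
  exact_mod_cast Nat.lt_succ_self N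

lemma main_bound (hα : -(1/2) ≤ α) (hq0 : 0 < q) (hq : q ≤ 1/16)
    (hqk : Real.sqrt q * (64 * (1 + |α|)^2) ≤ 1) {N : ℕ}
    (hN : ⌊(q ^ (-(1 : ℝ) / 4))^2⌋₊ + 1 ≤ N) :
    1 - (1 + 128 * (1 + |α|)^3) * Real.sqrt q ≤
      P.μ.real {ω | tauHigh P (q ^ (-(1 : ℝ) / 4)) ω ≤ (N : ℕ∞) ∧
                (N : ℕ∞) < tauLow P (q ^ (-(1 : ℝ) / 4)) (8 * (1 + |α|)) ω} := by
  have := P.isProb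
  set A := q ^ (-(1 : ℝ) / 4) with hA
  have hA0 : 0 < A := Real.rpow_pos_of_pos hq0 _
  have hAq : A ^ 2 * Real.sqrt q = 1 := by
    rw [hA, Real.sqrt_eq_rpow, ← Real.rpow_natCast, ← Real.rpow_mul hq0.le, ← Real.rpow_add hq0]
    norm_num
  have hsq0 : 0 < Real.sqrt q := Real.sqrt_pos.2 hq0
  have hsq : Real.sqrt q * Real.sqrt q = q := Real.mul_self_sqrt hq0.le
  set m := ⌊A^2⌋₊ + 1 with hm
  have h1 : A ^ 2 < m := by rw [hm]; push_cast; exact Nat.lt_floor_add_one _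
  have h2 : (m:ℝ) - 1 ≤ A ^ 2 := by
    rw [hm]; push_cast
    have := Nat.floor_le (sq_nonneg A)
    linarith
  have hm1 : 1 ≤ m := by omega
  have hm0 : (0:ℝ) < m := by positivity
  set k := 1 + |α| with hk
  have hk1 : 1 ≤ k := by have := abs_nonneg α; linarith
  have hB : 8 * k < Real.sqrt m := by
    apply Real.lt_sqrt_of_sq_lt
    refine lt_of_le_of_lt ?_ h1
    have : 0 ≤ A^2 * (1 - Real.sqrt q * (64 * k^2)) := mul_nonneg (sq_nonneg A) (by linarith)
    have e : A^2 * (1 - Real.sqrt q * (64 * k^2)) = A^2 - (A^2 * Real.sqrt q) * (64 * k^2) := by ring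
    rw [e, hAq] at this
    nlinarith
  have hGb := P.G_bound hα hq0 hq hm1 hN hB
  have hE := P.E_prob hα hq0 (by linarith) hm1
  have hsub := measureReal_mono (μ := P.μ) (P.G_sub hα hA0 hm1 hN h1 h2)
  refine le_trans ?_ hsub
  have hGE : P.G m N ⊆ P.E m := Set.inter_subset_left
  have hd := measureReal_diff (μ := P.μ) hGE (P.F_le N _ (P.G_meas hm1 hN))
  have hnn : 0 ≤ 64 * k^3 * ((Zvs α N * N) *
      ∫ ω, (P.G m N).indicator (fun ω => 1 / P.X N ω ^ 2) ω ∂P.μ) := by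
    have hZ := Zvs_ge hα (hm1.trans hN)
    have : 0 ≤ ∫ ω, (P.G m N).indicator (fun ω => 1 / P.X N ω ^ 2) ω ∂P.μ :=
      integral_nonneg fun ω => Set.indicator_nonneg (fun ω _ => by positivity) ω
    positivity
  have h5 : 128 * k^3 / m ≤ 128 * k^3 * Real.sqrt q := by
    rw [div_le_iff₀ hm0, mul_assoc]
    have : 1 ≤ Real.sqrt q * m := by nlinarith
    have h6 : 0 ≤ 128 * k^3 := by positivity
    nlinarith
  have h6 : ((m:ℝ) - 1) * q ≤ Real.sqrt q := by
    calc ((m:ℝ) - 1) * q ≤ A^2 * q := by gcongr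
      _ = (A^2 * Real.sqrt q) * Real.sqrt q := by rw [mul_assoc, hsq]
      _ = _ := by rw [hAq, one_mul]
  nlinarith

end VSIProcess

/-- For very simple increasing trees there are `B > 1` and `c_{α,2} > 0` such that for every
`q ∈ (0,1]`, with `A = q^(-1/4)`,
`liminf_N μ(τ_high(A) ≤ N, τ_low(B) > N) ≥ 1 - c_{α,2} √q`. -/
theorem vsi_good_event_bound (α : ℝ) (hα : α ∈ vsiAllowed) :
    ∃ B c : ℝ, 1 < B ∧ 0 < c ∧
      ∀ q : ℝ, 0 < q → q ≤ 1 →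
        ∀ (Ω : Type) [MeasurableSpace Ω] (P : VSIProcess α q Ω),
          1 - c * Real.sqrt q ≤
            Filter.liminf (fun N : ℕ =>
              (P.μ {ω | tauHigh P (q ^ (-(1 : ℝ) / 4)) ω ≤ (N : ℕ∞) ∧
                (N : ℕ∞) < tauLow P (q ^ (-(1 : ℝ) / 4)) B ω}).toReal)
              Filter.atTop := by
  have hα' := vsi_alpha_ge hα
  have hk1 : 1 ≤ 1 + |α| := by have := abs_nonneg α; linarith
  refine ⟨8 * (1 + |α|), 1 + 128 * (1 + |α|)^3 + 64 * (1 + |α|)^2, by linarith, by positivity, ?_⟩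
  intro q hq0 hq1 Ω _ P
  have := P.isProb
  have hsq0 : 0 < Real.sqrt q := Real.sqrt_pos.2 hq0
  have hsq : Real.sqrt q * Real.sqrt q = q := Real.mul_self_sqrt hq0.le
  apply le_liminf_of_le
  · refine IsBoundedUnder.isCoboundedUnder_ge ⟨1, ?_⟩
    rw [eventually_map]
    exact Eventually.of_forall fun N => measureReal_le_one
  · filter_upwards [eventually_ge_atTop (⌊(q ^ (-(1 : ℝ) / 4))^2⌋₊ + 1)] with N hN
    have h64 : 64 ≤ 64 * (1 + |α|)^2 := by nlinarith
    have h128 : 0 ≤ 128 * (1 + |α|)^3 := by positivity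
    by_cases hc : Real.sqrt q * (64 * (1 + |α|)^2) ≤ 1
    · have hq : q ≤ 1/16 := by
        have : Real.sqrt q ≤ 1/64 := by nlinarith
        nlinarith
      have := P.main_bound hα' hq0 hq hc hN
      have h0 : 0 ≤ 64 * (1 + |α|)^2 * Real.sqrt q := by positivity
      refine le_trans ?_ this
      linarith
    · refine le_trans ?_ ENNReal.toReal_nonneg
      have h0 : 0 ≤ 128 * (1 + |α|)^3 * Real.sqrt q := by positivity
      linarith
end
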